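/- Let ℋ be a positive function of class C^{1,α} (0 < α < 1) on an open set O ⊆ ℝ³, and let z be an elliptic solution of the prescribed mean curvature equation for ℋ on a punctured disk Ω centered at (x₀,y₀), such that the Hessian determinant z_xx z_yy − z_xy² is nonvanishing on some punctured neighborhood of (x₀,y₀) and the singularity of z at (x₀,y₀) is non-removable. Then there exists a punctured neighborhood V of (x₀,y₀) on which the function (x,y) ↦ [(2 − z_x² − z_y²)/√(1 − z_x² − z_y²)] · |z_xx z_yy − z_xy²| is Lebesgue integrable: ∫_V (2 − z_x² − z_y²)(1 − z_x² − z_y²)^{−1/2} |z_xx z_yy − z_xy²| dx dy < ∞. -/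

import Mathlib

noncomputable section

open Real Set Metric Filter MeasureTheory

/-- Points of Minkowski 3-space, as nested pairs. -/
abbrev R3 : Type := ℝ × ℝ × ℝ

/-- The Lorentzian inner product `⟨a,b⟩_L = a₁b₁ + a₂b₂ − a₃b₃` of Minkowski 3-space. -/
def lor (a b : R3) : ℝ := a.1 * b.1 + a.2.1 * b.2.1 - a.2.2 * b.2.2

/-- The Lorentzian cross product
`a ×_L b = (a₃b₂ − a₂b₃, a₁b₃ − a₃b₁, a₁b₂ − a₂b₁)`. -/
def lcross (a b : R3) : R3 :=
  (a.2.2 * b.2.1 - a.2.1 * b.2.2, a.1 * b.2.2 - a.2.2 * b.1, a.1 * b.2.1 - a.2.1 * b.1)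

/-- Partial derivative with respect to the first variable. -/
def pd1 {E : Type*} [NormedAddCommGroup E] [NormedSpace ℝ E]
    (f : ℝ × ℝ → E) (p : ℝ × ℝ) : E := fderiv ℝ f p (1, 0)

/-- Partial derivative with respect to the second variable. -/
def pd2 {E : Type*} [NormedAddCommGroup E] [NormedSpace ℝ E]
    (f : ℝ × ℝ → E) (p : ℝ × ℝ) : E := fderiv ℝ f p (0, 1)

def zx (z : ℝ × ℝ → ℝ) : ℝ × ℝ → ℝ := pd1 z
def zy (z : ℝ × ℝ → ℝ) : ℝ × ℝ → ℝ := pd2 z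
def zxx (z : ℝ × ℝ → ℝ) : ℝ × ℝ → ℝ := pd1 (zx z)
def zxy (z : ℝ × ℝ → ℝ) : ℝ × ℝ → ℝ := pd2 (zx z)
def zyy (z : ℝ × ℝ → ℝ) : ℝ × ℝ → ℝ := pd2 (zy z)

/-- Hessian determinant `z_xx z_yy − z_xy²`. -/
def hessDet (z : ℝ × ℝ → ℝ) (p : ℝ × ℝ) : ℝ := zxx z p * zyy z p - (zxy z p) ^ 2

/-- The punctured disk `{(x,y) : 0 < (x−x₀)² + (y−y₀)² < ρ²}`. -/
def PDisk (x₀ y₀ ρ : ℝ) : Set (ℝ × ℝ) :=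
  {p | 0 < (p.1 - x₀) ^ 2 + (p.2 - y₀) ^ 2 ∧ (p.1 - x₀) ^ 2 + (p.2 - y₀) ^ 2 < ρ ^ 2}

/-- `z` is an elliptic solution of the prescribed mean curvature equation for `H` on `U`,
with graph contained in `O`. -/
def IsEllSol (H : R3 → ℝ) (O : Set R3) (U : Set (ℝ × ℝ)) (z : ℝ × ℝ → ℝ) : Prop :=
  ContDiffOn ℝ 2 z U ∧
  (∀ p ∈ U, ((p.1, p.2, z p) : R3) ∈ O) ∧
  (∀ p ∈ U, (zx z p) ^ 2 + (zy z p) ^ 2 < 1) ∧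
  (∀ p ∈ U,
    (1 - (zy z p) ^ 2) * zxx z p + 2 * zx z p * zy z p * zxy z p
        + (1 - (zx z p) ^ 2) * zyy z p
      = 2 * H (p.1, p.2, z p) * (1 - (zx z p) ^ 2 - (zy z p) ^ 2) ^ ((3 : ℝ) / 2))

/-- The isolated singularity of `z` at `(x₀,y₀)` is removable: some `C²` function on a full
disk centered at `(x₀,y₀)` agrees with `z` on a punctured neighborhood. -/
def RemovableSing (x₀ y₀ : ℝ) (z : ℝ × ℝ → ℝ) : Prop :=
  ∃ ε > 0, ∃ Z : ℝ × ℝ → ℝ,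
    ContDiffOn ℝ 2 Z (ball ((x₀, y₀) : ℝ × ℝ) ε) ∧
    ∀ p ∈ ball ((x₀, y₀) : ℝ × ℝ) ε, p ≠ (x₀, y₀) → Z p = z p

/-- `H` is of class `C^{k,α}` on `O`: it is `C^k` and its `k`-th derivative is locally
`α`-Hölder on `O`. -/
def IsCkalpha (k : ℕ) (α : NNReal) (H : R3 → ℝ) (O : Set R3) : Prop :=
  ContDiffOn ℝ k H O ∧
  ∀ p ∈ O, ∃ ε > 0, ∃ C : NNReal,
    HolderOnWith C α (iteratedFDeriv ℝ k H) (ball p ε ∩ O)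

/-- The open strip `ℝ × (0,R)`. -/
def Strip (R : ℝ) : Set (ℝ × ℝ) := {p | 0 < p.2 ∧ p.2 < R}

/-- The open strip `ℝ × (−R,R)`. -/
def Strip2 (R : ℝ) : Set (ℝ × ℝ) := {p | -R < p.2 ∧ p.2 < R}

/-- The half-open strip `ℝ × [0,R)`. -/
def StripCl (R : ℝ) : Set (ℝ × ℝ) := {p | 0 ≤ p.2 ∧ p.2 < R}

/-- First two components of `ψ`: the planar projection `Π = (ψ₁, ψ₂)`. -/
def Pi2 (ψ : ℝ × ℝ → R3) (p : ℝ × ℝ) : ℝ × ℝ := ((ψ p).1, (ψ p).2.1)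

def comp1 (ψ : ℝ × ℝ → R3) : ℝ × ℝ → ℝ := fun p => (ψ p).1
def comp2 (ψ : ℝ × ℝ → R3) : ℝ × ℝ → ℝ := fun p => (ψ p).2.1
def comp3 (ψ : ℝ × ℝ → R3) : ℝ × ℝ → ℝ := fun p => (ψ p).2.2

/-- `ψ : ℝ × (0,R) → ℝ³` is a conformal parametrization of the graph of `z` near the
singularity `(x₀,y₀)`: it is 2π-periodic in `u`, its planar projection induces a
diffeomorphism with positive Jacobian from `(ℝ/2πℤ) × (0,R)` onto a punctured
neighborhood `W ⊆ Ω` of `(x₀,y₀)`, its third component is `z` of the first two, and the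
conformality conditions hold. -/
def IsConfParam (z : ℝ × ℝ → ℝ) (Ω : Set (ℝ × ℝ)) (x₀ y₀ R : ℝ)
    (ψ : ℝ × ℝ → R3) : Prop :=
  0 < R ∧
  ContDiffOn ℝ 1 ψ (Strip R) ∧
  (∀ u v : ℝ, ψ (u + 2 * π, v) = ψ (u, v)) ∧
  (∃ W : Set (ℝ × ℝ), W ⊆ Ω ∧ ((x₀, y₀) : ℝ × ℝ) ∉ W ∧
      insert ((x₀, y₀) : ℝ × ℝ) W ∈ nhds ((x₀, y₀) : ℝ × ℝ) ∧
      Pi2 ψ '' Strip R = W) ∧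
  (∀ p ∈ Strip R, ∀ q ∈ Strip R, Pi2 ψ p = Pi2 ψ q →
      p.2 = q.2 ∧ ∃ n : ℤ, p.1 - q.1 = 2 * π * n) ∧
  (∀ p ∈ Strip R,
      0 < pd1 (comp1 ψ) p * pd2 (comp2 ψ) p - pd2 (comp1 ψ) p * pd1 (comp2 ψ) p) ∧
  (∀ p ∈ Strip R, comp3 ψ p = z (Pi2 ψ p)) ∧
  (∀ p ∈ Strip R,
      lor (pd1 ψ p) (pd1 ψ p) = lor (pd2 ψ p) (pd2 ψ p) ∧
      0 < lor (pd1 ψ p) (pd1 ψ p) ∧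
      lor (pd1 ψ p) (pd2 ψ p) = 0)

/-- `ψ` extends real-analytically across `v = 0`, with `ψ(u,0) = p₀` and
`∂_vψ(u,0) = A(u)(cos u, −sin u, 1)`. -/
def ExtAnal (ψ : ℝ × ℝ → R3) (R : ℝ) (p₀ : R3) (A : ℝ → ℝ) : Prop :=
  ∃ ε > 0, ∃ Ψ : ℝ × ℝ → R3,
    AnalyticOnNhd ℝ Ψ {p : ℝ × ℝ | -ε < p.2 ∧ p.2 < R} ∧
    (∀ p ∈ Strip R, Ψ p = ψ p) ∧
    (∀ u : ℝ, Ψ (u, 0) = p₀) ∧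
    (∀ u : ℝ, pd2 Ψ (u, 0) = (A u * Real.cos u, -(A u * Real.sin u), A u))

/-- The class `𝒜₂` of 2π-periodic, real-analytic, nowhere vanishing functions. -/
def MemA2 (A : ℝ → ℝ) : Prop :=
  AnalyticOnNhd ℝ A univ ∧ (∀ u : ℝ, A (u + 2 * π) = A u) ∧ ∀ u : ℝ, A u ≠ 0

/-- The class `𝒜₁`: elliptic solutions on a punctured disk of radius `ρ` centered at
`(x₀,y₀)`, extending continuously with value `z₀`, whose Hessian determinant is
nonvanishing on a punctured neighborhood of `(x₀,y₀)`. -/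
def MemA1 (H : R3 → ℝ) (O : Set R3) (x₀ y₀ z₀ ρ : ℝ) (z : ℝ × ℝ → ℝ) : Prop :=
  0 < ρ ∧ IsEllSol H O (PDisk x₀ y₀ ρ) z ∧
  Tendsto z (nhdsWithin ((x₀, y₀) : ℝ × ℝ) (PDisk x₀ y₀ ρ)) (nhds z₀) ∧
  ∃ ε : ℝ, 0 < ε ∧ ε ≤ ρ ∧ ∀ p ∈ PDisk x₀ y₀ ε, hessDet z p ≠ 0

/-- `z` corresponds to `A`: some conformal parametrization of the graph of `z` near the
singularity extends real-analytically across `v = 0` with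
`∂_vψ(u,0) = A(u)(cos u, −sin u, 1)`. -/
def Corr (z : ℝ × ℝ → ℝ) (x₀ y₀ z₀ ρ : ℝ) (A : ℝ → ℝ) : Prop :=
  ∃ R : ℝ, ∃ ψ : ℝ × ℝ → R3,
    IsConfParam z (PDisk x₀ y₀ ρ) x₀ y₀ R ψ ∧ ExtAnal ψ R ((x₀, y₀, z₀) : R3) A

/-- The induced (first fundamental form) metric of the graph of `z`,
`ds² = (1−z_x²)dx² − 2 z_x z_y dx dy + (1−z_y²)dy²`, as a bilinear form. -/
def dsq (z : ℝ × ℝ → ℝ) (p : ℝ × ℝ) (ξ η : ℝ × ℝ) : ℝ :=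
  (1 - (zx z p) ^ 2) * ξ.1 * η.1 - zx z p * zy z p * (ξ.1 * η.2 + ξ.2 * η.1)
    + (1 - (zy z p) ^ 2) * ξ.2 * η.2

/-- `(Ω, ds²)` is conformally equivalent to the planar domain `D`: there is a `C¹`
diffeomorphism `Φ : Ω → D` and a positive function `λ` with
`⟨DΦ(ξ), DΦ(η)⟩_euc = λ · ds²(ξ,η)`. -/
def ConfEquiv (z : ℝ × ℝ → ℝ) (Ω D : Set (ℝ × ℝ)) : Prop :=
  ∃ (Φ : ℝ × ℝ → ℝ × ℝ) (Φinv : ℝ × ℝ → ℝ × ℝ) (lam : ℝ × ℝ → ℝ),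
    ContDiffOn ℝ 1 Φ Ω ∧ ContDiffOn ℝ 1 Φinv D ∧
    (∀ p ∈ Ω, Φ p ∈ D ∧ Φinv (Φ p) = p) ∧
    (∀ q ∈ D, Φinv q ∈ Ω ∧ Φ (Φinv q) = q) ∧
    (∀ p ∈ Ω, 0 < lam p ∧
      ∀ ξ η : ℝ × ℝ, (fderiv ℝ Φ p ξ).1 * (fderiv ℝ Φ p η).1
          + (fderiv ℝ Φ p ξ).2 * (fderiv ℝ Φ p η).2 = lam p * dsq z p ξ η)

/-- The Jacobian bracket `u_x v_y − u_y v_x`. -/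
def jac (u v : ℝ × ℝ → ℝ) (p : ℝ × ℝ) : ℝ := pd1 u p * pd2 v p - pd2 u p * pd1 v p

/-- The Jacobian bracket of two compactly supported `C¹` functions has zero integral. -/
theorem integral_jac_eq_zero_of_hasCompactSupport {u v : ℝ × ℝ → ℝ} (hu : ContDiff ℝ 1 u)
    (hv : ContDiff ℝ 1 v) (cu : HasCompactSupport u) (cv : HasCompactSupport v) :
    ∫ p, jac u v p = 0 := by
  obtain ⟨Cu, hCu⟩ := hu.lipschitzWith_of_hasCompactSupport cu one_ne_zero
  obtain ⟨Cv, hCv⟩ := hv.lipschitzWith_of_hasCompactSupport cv one_ne_zero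
  have du := hu.differentiable one_ne_zero
  have dv := hv.differentiable one_ne_zero
  have cont (f : ℝ × ℝ → ℝ) (hf : ContDiff ℝ 1 f) (w : ℝ × ℝ) :
      Continuous fun p => fderiv ℝ f p w :=
    (hf.continuous_fderiv one_ne_zero).clm_apply continuous_const
  have cpt (f : ℝ × ℝ → ℝ) (cf : HasCompactSupport f) (w : ℝ × ℝ) :
      HasCompactSupport fun p => fderiv ℝ f p w :=
    cf.fderiv_apply (𝕜 := ℝ) w
  have intg (f : ℝ × ℝ → ℝ) (hf : ContDiff ℝ 1 f) (cf : HasCompactSupport f) (w : ℝ × ℝ) :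
      Integrable (fun p => fderiv ℝ f p w) volume :=
    (cont f hf w).integrable_of_hasCompactSupport (cpt f cf w)
  have h₁ := hCu.integral_inv_smul_sub_mul_tendsto_integral_lineDeriv_mul (μ := volume)
    (intg v hv cv (0, 1)) (1, 0)
  have h₂ := hCv.integral_inv_smul_sub_mul_tendsto_integral_lineDeriv_mul (μ := volume)
    (intg u hu cu (0, 1)) (-(1, 0))
  have key : ∀ t : ℝ,
      (∫ x, (t⁻¹ • (u (x + t • (1, 0)) - u x)) * fderiv ℝ v x (0, 1))
        = -∫ x, (t⁻¹ • (v (x + t • (-(1, 0))) - v x)) * fderiv ℝ u x (0, 1) := by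
    intro t
    have i₁ : ∀ w : ℝ × ℝ, ∀ f g : ℝ × ℝ → ℝ, Continuous f → Continuous g →
        HasCompactSupport g → Integrable (fun x => f (x + w) * g x) volume := by
      intro w f g hf hg cg
      exact ((hf.comp (continuous_id.add continuous_const)).mul hg).integrable_of_hasCompactSupport
        cg.mul_left
    have ibp : ∀ w : ℝ × ℝ, (∫ x, u (x + w) * fderiv ℝ v x (0, 1))
        = -∫ x, fderiv ℝ u (x + w) (0, 1) * v x := by
      intro w
      have hd : ∀ x, fderiv ℝ (fun x => u (x + w)) x = fderiv ℝ u (x + w) := fun x =>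
        fderiv_comp_add_right w
      have := integral_mul_fderiv_eq_neg_fderiv_mul_of_integrable (μ := volume)
        (f := fun x => u (x + w)) (g := v) (v := ((0 : ℝ), (1 : ℝ)))
        (by simp_rw [hd]; exact i₁ w (fun x => fderiv ℝ u x (0, 1)) v (cont u hu _)
              hv.continuous cv)
        (i₁ w u _ hu.continuous (cont v hv _) (cpt v cv _))
        (i₁ w u v hu.continuous hv.continuous cv)
        (fun x _ => (du (x + w)).comp x ((differentiableAt_id).add_const w)) (fun x _ => dv x)
      simpa [hd] using this
    have e₁ := ibp (t • (1, 0))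
    have e₂ := ibp 0
    have e₃ : (∫ x, fderiv ℝ u (x + t • (1, 0)) (0, 1) * v x)
        = ∫ x, v (x + t • (-(1, 0))) * fderiv ℝ u x (0, 1) := by
      rw [← integral_add_right_eq_self (fun x => v (x + t • (-(1, 0))) * fderiv ℝ u x (0, 1))
        (t • ((1 : ℝ), (0 : ℝ)))]
      congr 1
      ext x
      rw [smul_neg, add_neg_cancel_right, mul_comm]
    simp only [add_zero] at e₂
    have s₁ : (∫ x, (t⁻¹ • (u (x + t • (1, 0)) - u x)) * fderiv ℝ v x (0, 1))
        = t⁻¹ * ((∫ x, u (x + t • (1, 0)) * fderiv ℝ v x (0, 1))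
          - ∫ x, u x * fderiv ℝ v x (0, 1)) := by
      rw [← integral_sub (i₁ _ u _ hu.continuous (cont v hv _) (cpt v cv _))
        (by simpa using i₁ 0 u _ hu.continuous (cont v hv _) (cpt v cv _)),
        ← integral_const_mul]
      congr 1; ext x; simp only [smul_eq_mul]; ring
    have s₂ : (∫ x, (t⁻¹ • (v (x + t • (-(1, 0))) - v x)) * fderiv ℝ u x (0, 1))
        = t⁻¹ * ((∫ x, v (x + t • (-(1, 0))) * fderiv ℝ u x (0, 1))
          - ∫ x, v x * fderiv ℝ u x (0, 1)) := by
      rw [← integral_sub (i₁ _ v _ hv.continuous (cont u hu _) (cpt u cu _))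
        (by simpa using i₁ 0 v _ hv.continuous (cont u hu _) (cpt u cu _)),
        ← integral_const_mul]
      congr 1; ext x; simp only [smul_eq_mul]; ring
    rw [s₁, s₂, e₁, e₂, e₃]
    simp_rw [mul_comm (fderiv ℝ u _ (0, 1)) (v _)]
    ring
  simp_rw [key] at h₁
  have hlim := tendsto_nhds_unique h₁ h₂.neg
  simp_rw [(du _).lineDeriv_eq_fderiv, (dv _).lineDeriv_eq_fderiv, map_neg, neg_mul,
    integral_neg, neg_neg] at hlim
  unfold jac pd1 pd2
  rw [integral_sub, hlim, sub_eq_zero]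
  · congr 1; ext x; ring
  · exact ((cont u hu _).mul (cont v hv _)).integrable_of_hasCompactSupport (cpt v cv _).mul_left
  · exact ((cont u hu _).mul (cont v hv _)).integrable_of_hasCompactSupport (cpt v cv _).mul_left

theorem contDiff_indicator_of_eq_zero {U K : Set (ℝ × ℝ)} (hU : IsOpen U) (hK : IsCompact K)
    {u : ℝ × ℝ → ℝ} (hu : ContDiffOn ℝ 1 u U) (h0 : ∀ p ∈ U, p ∉ K → u p = 0) (hKU : K ⊆ U) :
    ContDiff ℝ 1 (U.indicator u) := by
  rw [contDiff_iff_contDiffAt]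
  intro p
  by_cases hp : p ∈ U
  · refine (hu.contDiffAt (hU.mem_nhds hp)).congr_of_eventuallyEq ?_
    filter_upwards [hU.mem_nhds hp] with q hq
    exact indicator_of_mem hq u
  · have hpK : p ∉ K := fun h => hp (hKU h)
    refine (contDiffAt_const (c := (0 : ℝ))).congr_of_eventuallyEq ?_
    filter_upwards [hK.isClosed.isOpen_compl.mem_nhds hpK] with q hq
    by_cases hqU : q ∈ U
    · rw [indicator_of_mem hqU, h0 q hqU hq]
    · exact indicator_of_notMem hqU u

theorem hasCompactSupport_indicator_of_eq_zero {U K : Set (ℝ × ℝ)} (hK : IsCompact K)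
    {u : ℝ × ℝ → ℝ} (h0 : ∀ p ∈ U, p ∉ K → u p = 0) : HasCompactSupport (U.indicator u) := by
  refine HasCompactSupport.intro hK fun p hp => ?_
  by_cases hpU : p ∈ U
  · rw [indicator_of_mem hpU, h0 p hpU hp]
  · exact indicator_of_notMem hpU u

theorem integrableOn_of_eq_zero {U K : Set (ℝ × ℝ)} (hU : IsOpen U) (hK : IsCompact K)
    (hKU : K ⊆ U) {u : ℝ × ℝ → ℝ} (hu : ContinuousOn u U) (h0 : ∀ p ∈ U, p ∉ K → u p = 0) :
    IntegrableOn u U volume :=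
  ((hu.mono hKU).integrableOn_compact hK).of_forall_sdiff_eq_zero hU.measurableSet
    fun p hp => h0 p hp.1 hp.2

theorem pd_eq_of_eventuallyEq {u v : ℝ × ℝ → ℝ} {p : ℝ × ℝ} (h : u =ᶠ[nhds p] v) :
    pd1 u p = pd1 v p ∧ pd2 u p = pd2 v p := by
  simp [pd1, pd2, h.fderiv_eq]

theorem jac_congr {u u' v v' : ℝ × ℝ → ℝ} {p : ℝ × ℝ} (h : u =ᶠ[nhds p] u')
    (h' : v =ᶠ[nhds p] v') : jac u v p = jac u' v' p := by
  simp [jac, pd_eq_of_eventuallyEq h, pd_eq_of_eventuallyEq h']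

theorem pd_eq_zero_of_eq_const {u : ℝ × ℝ → ℝ} {V : Set (ℝ × ℝ)} (hV : IsOpen V) {c : ℝ}
    (h : ∀ p ∈ V, u p = c) {p : ℝ × ℝ} (hp : p ∈ V) : pd1 u p = 0 ∧ pd2 u p = 0 := by
  have : u =ᶠ[nhds p] fun _ => c := by
    filter_upwards [hV.mem_nhds hp] with q hq using h q hq
  simp [pd1, pd2, this.fderiv_eq]

/-- The Jacobian bracket `u_x v_y − u_y v_x` of `C¹` functions on an open set has zero integral
when `u` is compactly supported in that set. -/
theorem integral_jac_eq_zero {U K : Set (ℝ × ℝ)} (hU : IsOpen U) (hK : IsCompact K)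
    (hKU : K ⊆ U) {u v : ℝ × ℝ → ℝ} (hu : ContDiffOn ℝ 1 u U) (hv : ContDiffOn ℝ 1 v U)
    (h0 : ∀ p ∈ U, p ∉ K → u p = 0) : ∫ p in U, jac u v p = 0 := by
  obtain ⟨K', hK', hKK', hK'U⟩ := exists_compact_between hK hU hKU
  obtain ⟨χ, hχ1, hχ0, -⟩ := exists_contMDiffMap_one_nhds_of_subset_interior
    (modelWithCornersSelf ℝ (ℝ × ℝ)) (n := 1) hK.isClosed hKK'
  have hχ : ContDiff ℝ 1 χ := by
    have := χ.contMDiff.contDiff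
    exact_mod_cast this
  have hw : ContDiffOn ℝ 1 (fun p => χ p * v p) U := hχ.contDiffOn.mul hv
  have hw0 : ∀ p ∈ U, p ∉ K' → χ p * v p = 0 := fun p _ hp => by rw [hχ0 p hp, zero_mul]
  have main := integral_jac_eq_zero_of_hasCompactSupport
    (contDiff_indicator_of_eq_zero hU hK hu h0 hKU)
    (contDiff_indicator_of_eq_zero hU hK' hw hw0 hK'U)
    (hasCompactSupport_indicator_of_eq_zero hK h0)
    (hasCompactSupport_indicator_of_eq_zero hK' hw0)
  rw [← main, ← integral_indicator hU.measurableSet]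
  congr 1
  ext p
  by_cases hp : p ∈ U
  · rw [indicator_of_mem hp]
    have eu : u =ᶠ[nhds p] U.indicator u := by
      filter_upwards [hU.mem_nhds hp] with q hq using (indicator_of_mem hq u).symm
    by_cases hpK : p ∈ K
    · refine jac_congr eu ?_
      filter_upwards [hU.mem_nhds hp, hχ1.filter_mono (nhds_le_nhdsSet hpK)] with q hq hq1
      rw [indicator_of_mem hq, hq1, one_mul]
    · have h := pd_eq_zero_of_eq_const (hU.inter hK.isClosed.isOpen_compl)
        (fun q hq => h0 q hq.1 hq.2) ⟨hp, hpK⟩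
      have h' := pd_eq_of_eventuallyEq eu
      simp [jac, ← h'.1, ← h'.2, h.1, h.2]
  · have hpK : p ∉ K := fun h => hp (hKU h)
    have h := pd_eq_zero_of_eq_const (u := U.indicator u) hK.isClosed.isOpen_compl (c := 0)
      (fun q hq => by
        by_cases hqU : q ∈ U
        · rw [indicator_of_mem hqU, h0 q hqU hq]
        · exact indicator_of_notMem hqU u) hpK
    rw [indicator_of_notMem hp]
    simp [jac, h.1, h.2]

theorem pd_mul {u v : ℝ × ℝ → ℝ} {p : ℝ × ℝ} (hu : DifferentiableAt ℝ u p)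
    (hv : DifferentiableAt ℝ v p) :
    pd1 (fun q => u q * v q) p = u p * pd1 v p + v p * pd1 u p ∧
      pd2 (fun q => u q * v q) p = u p * pd2 v p + v p * pd2 u p := by
  simp [pd1, pd2, fderiv_fun_mul hu hv]

theorem pd_sub {u v : ℝ × ℝ → ℝ} {p : ℝ × ℝ} (hu : DifferentiableAt ℝ u p)
    (hv : DifferentiableAt ℝ v p) :
    pd1 (fun q => u q - v q) p = pd1 u p - pd1 v p ∧
      pd2 (fun q => u q - v q) p = pd2 u p - pd2 v p := by
  simp [pd1, pd2, fderiv_fun_sub hu hv]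

theorem pd_comp_prodMk {g X Y : ℝ × ℝ → ℝ} {p : ℝ × ℝ} (hg : DifferentiableAt ℝ g (X p, Y p))
    (hX : DifferentiableAt ℝ X p) (hY : DifferentiableAt ℝ Y p) :
    pd1 (fun q => g (X q, Y q)) p
        = pd1 g (X p, Y p) * pd1 X p + pd2 g (X p, Y p) * pd1 Y p ∧
      pd2 (fun q => g (X q, Y q)) p
        = pd1 g (X p, Y p) * pd2 X p + pd2 g (X p, Y p) * pd2 Y p := by
  have h : HasFDerivAt (fun q => g (X q, Y q))
      ((fderiv ℝ g (X p, Y p)).comp ((fderiv ℝ X p).prod (fderiv ℝ Y p))) p :=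
    HasFDerivAt.comp p hg.hasFDerivAt (hX.hasFDerivAt.prodMk hY.hasFDerivAt)
  have split (L : ℝ × ℝ →L[ℝ] ℝ) (a b : ℝ) : L (a, b) = L (1, 0) * a + L (0, 1) * b := by
    have : (a, b) = a • ((1 : ℝ), (0 : ℝ)) + b • ((0 : ℝ), (1 : ℝ)) := by simp
    rw [this, map_add, map_smul, map_smul, smul_eq_mul, smul_eq_mul]; ring
  simp only [pd1, pd2, h.fderiv, ContinuousLinearMap.comp_apply, ContinuousLinearMap.prod_apply]
  exact ⟨split _ _ _, split _ _ _⟩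

theorem contDiffOn_pd {u : ℝ × ℝ → ℝ} {U : Set (ℝ × ℝ)} (hU : IsOpen U) {m n : ℕ∞}
    (hu : ContDiffOn ℝ n u U) (hmn : m + 1 ≤ n) :
    ContDiffOn ℝ m (pd1 u) U ∧ ContDiffOn ℝ m (pd2 u) U := by
  have h : ContDiffOn ℝ m (fderiv ℝ u) U := hu.fderiv_of_isOpen hU (by exact_mod_cast hmn)
  exact ⟨h.clm_apply contDiffOn_const, h.clm_apply contDiffOn_const⟩

theorem continuousOn_jac {u v : ℝ × ℝ → ℝ} {U : Set (ℝ × ℝ)} (hU : IsOpen U)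
    (hu : ContDiffOn ℝ 1 u U) (hv : ContDiffOn ℝ 1 v U) : ContinuousOn (jac u v) U := by
  have h := contDiffOn_pd (m := 0) (n := 1) hU hu (by simp)
  have h' := contDiffOn_pd (m := 0) (n := 1) hU hv (by simp)
  exact (h.1.continuousOn.mul h'.2.continuousOn).sub (h.2.continuousOn.mul h'.1.continuousOn)

theorem pd_comm {u : ℝ × ℝ → ℝ} {p : ℝ × ℝ} (hu : ContDiffAt ℝ 2 u p) :
    pd1 (pd2 u) p = pd2 (pd1 u) p := by
  have hd : DifferentiableAt ℝ (fderiv ℝ u) p :=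
    (hu.fderiv_right (m := 1) (by norm_num)).differentiableAt one_ne_zero
  have h := hu.isSymmSndFDerivAt (by simp)
  have e (w : ℝ × ℝ) (v : ℝ × ℝ) :
      fderiv ℝ (fun q => fderiv ℝ u q w) p v = fderiv ℝ (fderiv ℝ u) p v w := by
    rw [fderiv_clm_apply hd (differentiableAt_const w)]
    simp
  change fderiv ℝ (fun q => fderiv ℝ u q (0, 1)) p (1, 0)
    = fderiv ℝ (fun q => fderiv ℝ u q (1, 0)) p (0, 1)
  rw [e, e]
  exact h _ _

/-- The second-order integrand bounding the contribution of an inner cutoff `g`. -/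
def hessBound (g : ℝ × ℝ → ℝ) (p : ℝ × ℝ) : ℝ :=
  |pd2 (pd2 g) p| + |pd2 (pd1 g) p| + |pd1 (pd1 g) p|

theorem lintegral_hessBound_comp_le {U : Set (ℝ × ℝ)} (hU : IsOpen U) {X Y g : ℝ × ℝ → ℝ}
    (hX : ContDiffOn ℝ 1 X U) (hY : ContDiffOn ℝ 1 Y U)
    (hinj : InjOn (fun p => (X p, Y p)) U) :
    ∫⁻ p in U, ENNReal.ofReal (|jac X Y p| * hessBound g (X p, Y p))
      ≤ ∫⁻ p, ENNReal.ofReal (hessBound g p) := by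
  have hd : ∀ p ∈ U, HasFDerivWithinAt (fun p => (X p, Y p))
      ((fderiv ℝ X p).prod (fderiv ℝ Y p)) U p := fun p hp =>
    ((((hX.contDiffAt (hU.mem_nhds hp)).differentiableAt one_ne_zero).hasFDerivAt).prodMk
      (((hY.contDiffAt (hU.mem_nhds hp)).differentiableAt
        one_ne_zero).hasFDerivAt)).hasFDerivWithinAt
  have hdet (p : ℝ × ℝ) : ((fderiv ℝ X p).prod (fderiv ℝ Y p)).det = jac X Y p := by
    rw [ContinuousLinearMap.det, ← LinearMap.det_toMatrix (Module.Basis.finTwoProd ℝ),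
      Matrix.det_fin_two]
    simp [LinearMap.toMatrix_apply, jac, pd1, pd2]
  have := lintegral_image_eq_lintegral_abs_det_fderiv_mul volume hU.measurableSet hd hinj
    (fun q => ENNReal.ofReal (hessBound g q))
  simp_rw [hdet] at this
  simp_rw [ENNReal.ofReal_mul (abs_nonneg _)]
  rw [← this]
  exact setLIntegral_le_lintegral _ _

theorem abs_quadratic_combination_le {P Q A B C : ℝ} (h : P ^ 2 + Q ^ 2 ≤ 1) :
    |1 / 2 * P ^ 2 * A - P * Q * B + 1 / 2 * Q ^ 2 * C| ≤ |A| + |B| + |C| := by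
  have a₁ : |1 / 2 * P ^ 2| ≤ 1 := by
    rw [abs_of_nonneg (by positivity)]; nlinarith [sq_nonneg Q]
  have a₂ : |P * Q| ≤ 1 := by
    rw [abs_le]; constructor <;> nlinarith [sq_nonneg (P + Q), sq_nonneg (P - Q)]
  have a₃ : |1 / 2 * Q ^ 2| ≤ 1 := by
    rw [abs_of_nonneg (by positivity)]; nlinarith [sq_nonneg P]
  have b (x y : ℝ) (hx : |x| ≤ 1) : |x * y| ≤ |y| := by
    rw [abs_mul]; exact mul_le_of_le_one_left (abs_nonneg _) hx
  refine (abs_add_le _ _).trans (add_le_add ((abs_sub _ _).trans (add_le_add ?_ ?_)) ?_)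
  exacts [b _ _ a₁, b _ _ a₂, b _ _ a₃]

/-- Two integrations by parts for the Jacobian of the gradient `(P, Q)` of a function in the
coordinates `(X, Y)`: away from the inner cutoff `g`, only second derivatives of `g` matter. -/
theorem integral_cutoff_mul_jac_le {U K : Set (ℝ × ℝ)} (hU : IsOpen U) (hK : IsCompact K)
    (hKU : K ⊆ U) {X Y P Q η g : ℝ × ℝ → ℝ}
    (hX : ContDiffOn ℝ 1 X U) (hY : ContDiffOn ℝ 1 Y U) (hP : ContDiffOn ℝ 1 P U)
    (hQ : ContDiffOn ℝ 1 Q U) (hη : ContDiff ℝ 1 η) (hg : ContDiff ℝ 3 g)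
    (hgc : HasCompactSupport g)
    (hclosed : ∀ p ∈ U, jac P X p + jac Q Y p = 0)
    (hPQ : ∀ p ∈ U, P p ^ 2 + Q p ^ 2 ≤ 1)
    (hinj : InjOn (fun p => (X p, Y p)) U)
    (hφ : ∀ p ∈ U, p ∉ K → η p - g (X p, Y p) = 0)
    (hgK : ∀ p ∈ U, p ∉ K → pd1 g (X p, Y p) = 0 ∧ pd2 g (X p, Y p) = 0) :
    |∫ p in U, (η p - g (X p, Y p)) * jac P Q p|
      ≤ (∫ p in U, |P p * jac η Q p|) + ∫ p, hessBound g p := by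
  have T : ContDiffOn ℝ 1 (fun p => (X p, Y p)) U := hX.prodMk hY
  have g1 : ContDiff ℝ 2 (pd1 g) ∧ ContDiff ℝ 2 (pd2 g) := by
    simpa [contDiffOn_univ] using
      contDiffOn_pd (m := 2) (n := 3) isOpen_univ hg.contDiffOn (by norm_num)
  have g11 : ContDiff ℝ 1 (pd1 (pd1 g)) ∧ ContDiff ℝ 1 (pd2 (pd1 g)) := by
    simpa [contDiffOn_univ] using
      contDiffOn_pd (m := 1) (n := 2) isOpen_univ g1.1.contDiffOn (by norm_num)
  have g22 : ContDiff ℝ 1 (pd1 (pd2 g)) ∧ ContDiff ℝ 1 (pd2 (pd2 g)) := by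
    simpa [contDiffOn_univ] using
      contDiffOn_pd (m := 1) (n := 2) isOpen_univ g1.2.contDiffOn (by norm_num)
  have hd {f : ℝ × ℝ → ℝ} (hf : ContDiffOn ℝ 1 f U) {p : ℝ × ℝ} (hp : p ∈ U) :
      DifferentiableAt ℝ f p := (hf.contDiffAt (hU.mem_nhds hp)).differentiableAt one_ne_zero
  have hgT : ContDiffOn ℝ 1 (fun p => g (X p, Y p)) U := (hg.of_le (by norm_num)).comp_contDiffOn T
  have hg1T : ContDiffOn ℝ 1 (fun p => pd1 g (X p, Y p)) U :=
    (g1.1.of_le (by norm_num)).comp_contDiffOn T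
  have hg2T : ContDiffOn ℝ 1 (fun p => pd2 g (X p, Y p)) U :=
    (g1.2.of_le (by norm_num)).comp_contDiffOn T
  have hφC : ContDiffOn ℝ 1 (fun p => η p - g (X p, Y p)) U := hη.contDiffOn.sub hgT
  set φ : ℝ × ℝ → ℝ := fun p => η p - g (X p, Y p) with hφdef
  have hφ' : ∀ p ∈ U, p ∉ K → φ p = 0 := hφ
  have hη0 : ∀ p ∈ U, p ∉ K → pd1 η p = 0 ∧ pd2 η p = 0 := by
    intro p hp hpK
    have h := pd_eq_zero_of_eq_const (hU.inter hK.isClosed.isOpen_compl)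
      (fun q hq => hφ q hq.1 hq.2) ⟨hp, hpK⟩
    have h' := pd_sub (hη.differentiable one_ne_zero p) (hd hgT hp)
    have h'' := pd_comp_prodMk (hg.differentiable (by norm_num) (X p, Y p)) (hd hX hp) (hd hY hp)
    rw [(hgK p hp hpK).1, (hgK p hp hpK).2] at h''
    rw [h.1, h.2, h''.1, h''.2] at h'
    constructor <;> linarith [h'.1, h'.2]
  have C₁ : ContDiffOn ℝ 1 (fun p => φ p * P p) U := hφC.mul hP
  have C₂ : ContDiffOn ℝ 1 (fun p => pd2 g (X p, Y p) * (P p * P p)) U := hg2T.mul (hP.mul hP)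
  have C₃ : ContDiffOn ℝ 1 (fun p => pd1 g (X p, Y p) * (P p * Q p)) U := hg1T.mul (hP.mul hQ)
  have C₄ : ContDiffOn ℝ 1 (fun p => pd1 g (X p, Y p) * (Q p * Q p)) U := hg1T.mul (hQ.mul hQ)
  have Z₁ := integral_jac_eq_zero hU hK hKU C₁ hQ
    (fun p hp hpK => by rw [hφ' p hp hpK, zero_mul])
  have Z₂ := integral_jac_eq_zero hU hK hKU C₂ hX
    (fun p hp hpK => by rw [(hgK p hp hpK).2, zero_mul])
  have Z₃ := integral_jac_eq_zero hU hK hKU C₃ hX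
    (fun p hp hpK => by rw [(hgK p hp hpK).1, zero_mul])
  have Z₄ := integral_jac_eq_zero hU hK hKU C₄ hY
    (fun p hp hpK => by rw [(hgK p hp hpK).1, zero_mul])
  have jac0 {u v : ℝ × ℝ → ℝ} (h0 : ∀ p ∈ U, p ∉ K → u p = 0) : ∀ p ∈ U, p ∉ K → jac u v p = 0 := by
    intro p hp hpK
    have h := pd_eq_zero_of_eq_const (hU.inter hK.isClosed.isOpen_compl)
      (fun q hq => h0 q hq.1 hq.2) ⟨hp, hpK⟩
    simp [jac, h.1, h.2]
  have L₁ := integrableOn_of_eq_zero hU hK hKU (continuousOn_jac hU C₁ hQ)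
    (jac0 fun p hp hpK => by rw [hφ' p hp hpK, zero_mul])
  have L₂ := integrableOn_of_eq_zero hU hK hKU (continuousOn_jac hU C₂ hX)
    (jac0 fun p hp hpK => by rw [(hgK p hp hpK).2, zero_mul])
  have L₃ := integrableOn_of_eq_zero hU hK hKU (continuousOn_jac hU C₃ hX)
    (jac0 fun p hp hpK => by rw [(hgK p hp hpK).1, zero_mul])
  have L₄ := integrableOn_of_eq_zero hU hK hKU (continuousOn_jac hU C₄ hY)
    (jac0 fun p hp hpK => by rw [(hgK p hp hpK).1, zero_mul])
  have Lη : IntegrableOn (fun p => P p * jac η Q p) U :=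
    integrableOn_of_eq_zero hU hK hKU
      (hP.continuousOn.mul (continuousOn_jac hU hη.contDiffOn hQ))
      (fun p hp hpK => by simp [jac, (hη0 p hp hpK).1, (hη0 p hp hpK).2])
  have Lφ : IntegrableOn (fun p => φ p * jac P Q p) U :=
    integrableOn_of_eq_zero hU hK hKU
      (hφC.continuousOn.mul (continuousOn_jac hU hP hQ))
      (fun p hp hpK => by rw [hφ' p hp hpK, zero_mul])
  set R : ℝ × ℝ → ℝ := fun p => φ p * jac P Q p - jac (fun p => φ p * P p) Q p + P p * jac η Q p
    - 1 / 2 * jac (fun p => pd2 g (X p, Y p) * (P p * P p)) X p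
    + jac (fun p => pd1 g (X p, Y p) * (P p * Q p)) X p
    + 1 / 2 * jac (fun p => pd1 g (X p, Y p) * (Q p * Q p)) Y p with hR
  have M₁ : IntegrableOn (fun p => φ p * jac P Q p - jac (fun p => φ p * P p) Q p) U := Lφ.sub L₁
  have M₂ : IntegrableOn (fun p => φ p * jac P Q p - jac (fun p => φ p * P p) Q p
      + P p * jac η Q p) U := M₁.add Lη
  have L₂' : IntegrableOn
      (fun p => 1 / 2 * jac (fun p => pd2 g (X p, Y p) * (P p * P p)) X p) U := L₂.const_mul _
  have L₄' : IntegrableOn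
      (fun p => 1 / 2 * jac (fun p => pd1 g (X p, Y p) * (Q p * Q p)) Y p) U := L₄.const_mul _
  have M₃ : IntegrableOn (fun p => φ p * jac P Q p - jac (fun p => φ p * P p) Q p
      + P p * jac η Q p - 1 / 2 * jac (fun p => pd2 g (X p, Y p) * (P p * P p)) X p) U :=
    M₂.sub L₂'
  have M₄ : IntegrableOn (fun p => φ p * jac P Q p - jac (fun p => φ p * P p) Q p
      + P p * jac η Q p - 1 / 2 * jac (fun p => pd2 g (X p, Y p) * (P p * P p)) X p
      + jac (fun p => pd1 g (X p, Y p) * (P p * Q p)) X p) U := M₃.add L₃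
  have LR : IntegrableOn R U := M₄.add L₄'
  have hRint : ∫ p in U, R p = (∫ p in U, φ p * jac P Q p) + ∫ p in U, P p * jac η Q p := by
    rw [hR, integral_add M₄ L₄', integral_add M₃ L₃, integral_sub M₂ L₂', integral_add M₁ Lη,
      integral_sub Lφ L₁, integral_const_mul, integral_const_mul, Z₁, Z₂, Z₃, Z₄]
    ring
  have hRval : ∀ p ∈ U, |R p| ≤ |jac X Y p| * hessBound g (X p, Y p) := by
    intro p hp
    have dg1 := g1.1.differentiable (by norm_num) (X p, Y p)
    have dg2 := g1.2.differentiable (by norm_num) (X p, Y p)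
    have e₁ := pd_mul (hd hφC hp) (hd hP hp)
    have e₂ := pd_mul (hd hg2T hp) (hd (hP.mul hP) hp)
    have e₃ := pd_mul (hd hg1T hp) (hd (hP.mul hQ) hp)
    have e₄ := pd_mul (hd hg1T hp) (hd (hQ.mul hQ) hp)
    have f₂ := pd_mul (hd hP hp) (hd hP hp)
    have f₃ := pd_mul (hd hP hp) (hd hQ hp)
    have f₄ := pd_mul (hd hQ hp) (hd hQ hp)
    have k := pd_comp_prodMk (hg.differentiable (by norm_num) (X p, Y p)) (hd hX hp) (hd hY hp)
    have k₁ := pd_comp_prodMk dg1 (hd hX hp) (hd hY hp)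
    have k₂ := pd_comp_prodMk dg2 (hd hX hp) (hd hY hp)
    have kφ : pd1 φ p = pd1 η p - pd1 (fun q => g (X q, Y q)) p ∧
        pd2 φ p = pd2 η p - pd2 (fun q => g (X q, Y q)) p :=
      pd_sub (hη.differentiable one_ne_zero p) (hd hgT hp)
    have sym := pd_comm (u := g) (p := (X p, Y p)) (hg.of_le (by norm_num)).contDiffAt
    have cl := hclosed p hp
    have val : R p = jac X Y p * (1 / 2 * P p ^ 2 * pd2 (pd2 g) (X p, Y p)
        - P p * Q p * pd2 (pd1 g) (X p, Y p) + 1 / 2 * Q p ^ 2 * pd1 (pd1 g) (X p, Y p)) := by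
      simp only [hR, jac, e₁.1, e₁.2, e₂.1, e₂.2, e₃.1, e₃.2, e₄.1, e₄.2, f₂.1, f₂.2, f₃.1, f₃.2,
        f₄.1, f₄.2, kφ.1, kφ.2, k.1, k.2, k₁.1, k₁.2, k₂.1, k₂.2, sym]
      unfold jac at cl
      linear_combination (-pd2 g (X p, Y p) * P p + pd1 g (X p, Y p) * Q p) * cl
    rw [val, abs_mul]
    refine mul_le_mul_of_nonneg_left ?_ (abs_nonneg _)
    exact abs_quadratic_combination_le (hPQ p hp)
  have hbC : Continuous (hessBound g) :=
    (g22.2.continuous.abs.add g11.2.continuous.abs).add g11.1.continuous.abs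
  have hbS : HasCompactSupport (hessBound g) := by
    have c (f : ℝ × ℝ → ℝ) (cf : HasCompactSupport f) :
        HasCompactSupport (pd1 f) ∧ HasCompactSupport (pd2 f) :=
      ⟨cf.fderiv_apply (𝕜 := ℝ) _, cf.fderiv_apply (𝕜 := ℝ) _⟩
    have d₁ := c _ (c g hgc).1
    have d₂ := c _ (c g hgc).2
    exact ((d₂.2.abs).add d₁.2.abs).add d₁.1.abs
  have hb0 : ∀ p, 0 ≤ hessBound g p := fun p => by unfold hessBound; positivity
  have hbI : Integrable (hessBound g) volume := hbC.integrable_of_hasCompactSupport hbS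
  have hRb : |∫ p in U, R p| ≤ ∫ p, hessBound g p := by
    refine (abs_integral_le_integral_abs).trans ?_
    rw [integral_eq_lintegral_of_nonneg_ae (Eventually.of_forall fun p => abs_nonneg _)
      LR.aestronglyMeasurable.norm,
      integral_eq_lintegral_of_nonneg_ae (Eventually.of_forall hb0) hbC.aestronglyMeasurable]
    refine ENNReal.toReal_mono ?_ ?_
    · rw [← ofReal_integral_eq_lintegral_ofReal hbI (Eventually.of_forall hb0)]
      exact ENNReal.ofReal_ne_top
    · refine le_trans ?_ (lintegral_hessBound_comp_le hU hX hY hinj)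
      exact setLIntegral_mono' hU.measurableSet fun p hp => ENNReal.ofReal_le_ofReal (hRval p hp)
  have hηb : |∫ p in U, P p * jac η Q p| ≤ ∫ p in U, |P p * jac η Q p| :=
    abs_integral_le_integral_abs
  have : (∫ p in U, φ p * jac P Q p) = (∫ p in U, R p) - ∫ p in U, P p * jac η Q p := by
    rw [hRint]; ring
  rw [this]
  refine (abs_sub _ _).trans ?_
  linarith

/-- The Euclidean distance of two points of the plane `ℝ × ℝ`. -/
def ed (p q : ℝ × ℝ) : ℝ := ‖(⟨p.1 - q.1, p.2 - q.2⟩ : ℂ)‖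

theorem ed_nonneg (p q : ℝ × ℝ) : 0 ≤ ed p q := norm_nonneg _

theorem ed_sq (p q : ℝ × ℝ) : ed p q ^ 2 = (p.1 - q.1) ^ 2 + (p.2 - q.2) ^ 2 := by
  rw [ed, Complex.sq_norm, Complex.normSq_mk]; ring

theorem continuous_ed : Continuous fun x : (ℝ × ℝ) × (ℝ × ℝ) => ed x.1 x.2 := by
  have : (fun x : (ℝ × ℝ) × (ℝ × ℝ) => ed x.1 x.2)
      = fun x => √((x.1.1 - x.2.1) ^ 2 + (x.1.2 - x.2.2) ^ 2) := by
    ext x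
    rw [← ed_sq, Real.sqrt_sq (ed_nonneg _ _)]
  rw [this]
  fun_prop

theorem ed_le_add (p q c : ℝ × ℝ) : ed p q ≤ ed p c + ed q c := by
  unfold ed
  refine le_trans (le_of_eq ?_) (norm_sub_le _ _)
  congr 1
  apply Complex.ext <;> simp

theorem mem_pdisk_iff {x₀ y₀ ρ : ℝ} (hρ : 0 < ρ) {p : ℝ × ℝ} :
    p ∈ PDisk x₀ y₀ ρ ↔ 0 < ed p (x₀, y₀) ∧ ed p (x₀, y₀) < ρ := by
  have h := ed_nonneg p (x₀, y₀)
  simp only [PDisk, mem_ofPred_eq, ← ed_sq p (x₀, y₀)]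
  rw [sq_lt_sq₀ h hρ.le, sq_pos_iff, h.lt_iff_ne']

theorem isOpen_pdisk (x₀ y₀ ρ : ℝ) : IsOpen (PDisk x₀ y₀ ρ) :=
  (isOpen_lt (g := fun p : ℝ × ℝ => (p.1 - x₀) ^ 2 + (p.2 - y₀) ^ 2) continuous_const
    (by fun_prop)).and (isOpen_lt (by fun_prop) continuous_const)

theorem isPreconnected_pdisk (x₀ y₀ : ℝ) {ρ : ℝ} (hρ : 0 < ρ) :
    IsPreconnected (PDisk x₀ y₀ ρ) := by
  have : PDisk x₀ y₀ ρ = (fun v : ℝ × ℝ => (x₀ + v.1 * cos v.2, y₀ + v.1 * sin v.2)) ''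
      (Ioo 0 ρ ×ˢ univ) := by
    ext p
    constructor
    · intro hp
      refine ⟨(ed p (x₀, y₀), (⟨p.1 - x₀, p.2 - y₀⟩ : ℂ).arg), ⟨(mem_pdisk_iff hρ).1 hp,
        mem_univ _⟩, ?_⟩
      have h₁ := Complex.norm_mul_cos_arg (⟨p.1 - x₀, p.2 - y₀⟩ : ℂ)
      have h₂ := Complex.norm_mul_sin_arg (⟨p.1 - x₀, p.2 - y₀⟩ : ℂ)
      simp only [ed, h₁, h₂]
      ext <;> simp
    · rintro ⟨v, ⟨hv, -⟩, rfl⟩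
      have : (v.1 * cos v.2) ^ 2 + (v.1 * sin v.2) ^ 2 = v.1 ^ 2 := by
        linear_combination v.1 ^ 2 * sin_sq_add_cos_sq v.2
      simp only [PDisk, mem_ofPred_eq, add_sub_cancel_left, this]
      exact ⟨by have := hv.1; positivity, by nlinarith [hv.1, hv.2]⟩
  rw [this]
  refine IsPreconnected.image (((convex_Ioo 0 ρ).prod convex_univ).isPreconnected) _ ?_
  fun_prop

theorem abs_linear_combination_le {a b u v : ℝ} (h : a ^ 2 + b ^ 2 ≤ 1) :
    |a * u + b * v| ≤ ‖(⟨u, v⟩ : ℂ)‖ := by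
  apply abs_le_of_sq_le_sq _ (norm_nonneg _)
  rw [Complex.sq_norm, Complex.normSq_mk]
  nlinarith [sq_nonneg (a * v - b * u), sq_nonneg u, sq_nonneg v,
    mul_nonneg (sub_nonneg.2 h) (add_nonneg (sq_nonneg u) (sq_nonneg v))]

theorem fderiv_apply_eq_pd (u : ℝ × ℝ → ℝ) (p w : ℝ × ℝ) :
    fderiv ℝ u p w = pd1 u p * w.1 + pd2 u p * w.2 := by
  have : w = w.1 • ((1 : ℝ), (0 : ℝ)) + w.2 • ((0 : ℝ), (1 : ℝ)) := by ext <;> simp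
  conv_lhs => rw [this, map_add, map_smul, map_smul, smul_eq_mul, smul_eq_mul]
  rw [pd1, pd2]; ring

theorem abs_sub_le_ed_of_segment {U : Set (ℝ × ℝ)} {z : ℝ × ℝ → ℝ}
    (hd : ∀ p ∈ U, DifferentiableAt ℝ z p) (hgrad : ∀ p ∈ U, zx z p ^ 2 + zy z p ^ 2 ≤ 1)
    {p q : ℝ × ℝ} (hseg : ∀ t ∈ Icc (0 : ℝ) 1, p + t • (q - p) ∈ U) :
    |z q - z p| ≤ ed q p := by
  have hder : ∀ t ∈ Icc (0 : ℝ) 1, HasDerivAt (fun t : ℝ => z (p + t • (q - p)))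
      (zx z (p + t • (q - p)) * (q.1 - p.1) + zy z (p + t • (q - p)) * (q.2 - p.2)) t := by
    intro t ht
    have h₁ : HasDerivAt (fun t : ℝ => p + t • (q - p)) (q - p) t := by
      simpa using ((hasDerivAt_id t).smul_const (q - p)).const_add p
    have := (hd _ (hseg t ht)).hasFDerivAt.comp_hasDerivAt t h₁
    rw [fderiv_apply_eq_pd] at this
    exact this
  obtain ⟨t, ht, e⟩ := exists_hasDerivAt_eq_slope (fun t : ℝ => z (p + t • (q - p))) _ zero_lt_one
    (fun t ht => (hder t ht).continuousAt.continuousWithinAt)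
    (fun t ht => hder t (Ioo_subset_Icc_self ht))
  simp only [one_smul, zero_smul, add_zero, sub_zero, div_one, add_sub_cancel] at e
  rw [← e]
  exact abs_linear_combination_le (hgrad _ (hseg t (Ioo_subset_Icc_self ht)))

theorem segment_mem_pdisk {x₀ y₀ ρ : ℝ} {p q : ℝ × ℝ}
    (hp : p ∈ PDisk x₀ y₀ ρ) (hq : q ∈ PDisk x₀ y₀ ρ)
    (hcross : (q.1 - p.1) * (y₀ - p.2) - (q.2 - p.2) * (x₀ - p.1) ≠ 0) :
    ∀ t ∈ Icc (0 : ℝ) 1, p + t • (q - p) ∈ PDisk x₀ y₀ ρ := by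
  intro t ht
  have e : p + t • (q - p) = (p.1 + t * (q.1 - p.1), p.2 + t * (q.2 - p.2)) := by ext <;> simp
  rw [e]
  simp only [PDisk, mem_ofPred_eq] at hp hq ⊢
  constructor
  · by_contra hneg
    have h0 := le_antisymm (not_lt.1 hneg) (by positivity)
    have h₁ : p.1 + t * (q.1 - p.1) - x₀ = 0 := by
      nlinarith [sq_nonneg (p.1 + t * (q.1 - p.1) - x₀), sq_nonneg (p.2 + t * (q.2 - p.2) - y₀)]
    have h₂ : p.2 + t * (q.2 - p.2) - y₀ = 0 := by
      nlinarith [sq_nonneg (p.1 + t * (q.1 - p.1) - x₀), sq_nonneg (p.2 + t * (q.2 - p.2) - y₀)]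
    apply hcross
    linear_combination -(q.1 - p.1) * h₂ + (q.2 - p.2) * h₁
  · have h₁ := hp.2
    have h₂ := hq.2
    have k : (p.1 + t * (q.1 - p.1) - x₀) ^ 2 + (p.2 + t * (q.2 - p.2) - y₀) ^ 2
        = (1 - t) * ((p.1 - x₀) ^ 2 + (p.2 - y₀) ^ 2) + t * ((q.1 - x₀) ^ 2 + (q.2 - y₀) ^ 2)
          - t * (1 - t) * ((q.1 - p.1) ^ 2 + (q.2 - p.2) ^ 2) := by ring
    have k' : 0 ≤ t * (1 - t) * ((q.1 - p.1) ^ 2 + (q.2 - p.2) ^ 2) :=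
      mul_nonneg (mul_nonneg ht.1 (by linarith [ht.2])) (by positivity)
    rw [k]
    rcases ht.1.eq_or_lt with h | h
    · subst h; simpa using h₁
    · nlinarith [mul_lt_mul_of_pos_left h₂ h,
        mul_le_mul_of_nonneg_left h₁.le (by linarith [ht.2] : 0 ≤ 1 - t)]

/-- A function with gradient of length at most one on a punctured disk is `1`-Lipschitz. -/
theorem abs_sub_le_ed {x₀ y₀ ρ : ℝ} {z : ℝ × ℝ → ℝ}
    (hd : ∀ p ∈ PDisk x₀ y₀ ρ, DifferentiableAt ℝ z p)
    (hgrad : ∀ p ∈ PDisk x₀ y₀ ρ, zx z p ^ 2 + zy z p ^ 2 ≤ 1)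
    {p q : ℝ × ℝ} (hp : p ∈ PDisk x₀ y₀ ρ) (hq : q ∈ PDisk x₀ y₀ ρ) :
    |z q - z p| ≤ ed q p := by
  by_cases hcross : (q.1 - p.1) * (y₀ - p.2) - (q.2 - p.2) * (x₀ - p.1) = 0
  · let Γ : ℝ → ℝ × ℝ := fun τ => (q.1 - τ * (y₀ - p.2), q.2 + τ * (x₀ - p.1))
    have hΓ : Continuous Γ := by fun_prop
    have hΓ0 : Γ 0 = q := by ext <;> simp [Γ]
    have t₁ : Tendsto Γ (nhdsWithin 0 {0}ᶜ) (nhds q) := by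
      rw [← hΓ0]; exact hΓ.continuousAt.tendsto.mono_left nhdsWithin_le_nhds
    have t₂ : Tendsto (fun τ => |z (Γ τ) - z p|) (nhdsWithin 0 {0}ᶜ) (nhds |z q - z p|) :=
      (((hd q hq).continuousAt.tendsto.comp t₁).sub_const _).abs
    have t₃ : Tendsto (fun τ => ed (Γ τ) p) (nhdsWithin 0 {0}ᶜ) (nhds (ed q p)) :=
      ((continuous_ed.comp (continuous_id.prodMk continuous_const)).continuousAt.tendsto).comp t₁
    refine le_of_tendsto_of_tendsto t₂ t₃ ?_
    filter_upwards [t₁ ((isOpen_pdisk x₀ y₀ ρ).mem_nhds hq), self_mem_nhdsWithin] with τ h₁ h₂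
    refine abs_sub_le_ed_of_segment hd hgrad (segment_mem_pdisk hp h₁ ?_)
    have e : ((Γ τ).1 - p.1) * (y₀ - p.2) - ((Γ τ).2 - p.2) * (x₀ - p.1)
        = -(τ * ((p.1 - x₀) ^ 2 + (p.2 - y₀) ^ 2)) := by
      simp only [Γ]
      linear_combination hcross
    rw [e]
    exact neg_ne_zero.2 (mul_ne_zero h₂ hp.1.ne')
  · exact abs_sub_le_ed_of_segment hd hgrad (segment_mem_pdisk hp hq hcross)

theorem exists_abs_sub_le_ed {U : Set (ℝ × ℝ)} {z : ℝ × ℝ → ℝ} (c : ℝ × ℝ)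
    (hLip : ∀ p ∈ U, ∀ q ∈ U, |z q - z p| ≤ ed q p) : ∃ z₀, ∀ p ∈ U, |z p - z₀| ≤ ed p c := by
  rcases U.eq_empty_or_nonempty with rfl | ⟨q₀, hq₀⟩
  · exact ⟨0, by simp⟩
  have hb : ∀ q ∈ U, ∀ x ∈ (fun p => z p - ed p c) '' U, x ≤ z q + ed q c := by
    rintro q hq _ ⟨p, hp, rfl⟩
    have := (le_abs_self _).trans (hLip q hq p hp)
    have := ed_le_add p q c
    simp only
    linarith
  refine ⟨sSup ((fun p => z p - ed p c) '' U), fun p hp => abs_le.2 ⟨?_, ?_⟩⟩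
  · linarith [csSup_le ⟨_, mem_image_of_mem _ hq₀⟩ (hb p hp)]
  · linarith [le_csSup ⟨_, hb q₀ hq₀⟩ (mem_image_of_mem (fun p => z p - ed p c) hp)]

/-- A Lorentz boost of velocity `s` and Lorentz factor `1 / σ` in the horizontal direction
`(C, S)`. -/
structure Boost where
  C : ℝ
  S : ℝ
  s : ℝ
  σ : ℝ
  rot : C ^ 2 + S ^ 2 = 1
  hyp : s ^ 2 + σ ^ 2 = 1
  s_nonneg : 0 ≤ s
  s_lt_one : s < 1
  σ_pos : 0 < σ

namespace Boost

/-- The first boosted coordinate of the graph of `z`, scaled by `1 / δ`. -/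
def X (b : Boost) (z : ℝ × ℝ → ℝ) (c : ℝ × ℝ) (z₀ δ : ℝ) (p : ℝ × ℝ) : ℝ :=
  (b.C * (p.1 - c.1) + b.S * (p.2 - c.2) - b.s * (z p - z₀)) / (b.σ * δ)

/-- The second boosted coordinate of the graph of `z`, scaled by `1 / δ`. -/
def Y (b : Boost) (c : ℝ × ℝ) (δ : ℝ) (p : ℝ × ℝ) : ℝ :=
  (b.C * (p.2 - c.2) - b.S * (p.1 - c.1)) / δ

/-- The denominator in the transformation of slopes. -/
def den (b : Boost) (z : ℝ × ℝ → ℝ) (p : ℝ × ℝ) : ℝ :=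
  1 - b.s * (b.C * zx z p + b.S * zy z p)

/-- The first boosted slope. -/
def P (b : Boost) (z : ℝ × ℝ → ℝ) (p : ℝ × ℝ) : ℝ :=
  (b.C * zx z p + b.S * zy z p - b.s) / b.den z p

/-- The second boosted slope. -/
def Q (b : Boost) (z : ℝ × ℝ → ℝ) (p : ℝ × ℝ) : ℝ :=
  b.σ * (b.C * zy z p - b.S * zx z p) / b.den z p

variable (b : Boost) {z : ℝ × ℝ → ℝ} {p : ℝ × ℝ}

theorem half_le_den (h : zx z p ^ 2 + zy z p ^ 2 < 1) :
    (1 - zx z p ^ 2 - zy z p ^ 2) / 2 ≤ b.den z p := by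
  set a := b.C * zx z p + b.S * zy z p with ha
  have h₁ : a ^ 2 ≤ zx z p ^ 2 + zy z p ^ 2 := by
    have := b.rot
    have e : zx z p ^ 2 + zy z p ^ 2 - a ^ 2 = (b.C * zy z p - b.S * zx z p) ^ 2 := by
      rw [ha]; linear_combination (-(zx z p ^ 2) - zy z p ^ 2) * b.rot
    nlinarith [sq_nonneg (b.C * zy z p - b.S * zx z p)]
  have h₂ : |a| < 1 := by rw [← sq_lt_one_iff_abs_lt_one]; linarith
  have h₃ : b.s * a ≤ |a| := by
    refine (mul_le_mul_of_nonneg_left (le_abs_self a) b.s_nonneg).trans ?_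
    exact mul_le_of_le_one_left (abs_nonneg _) b.s_lt_one.le
  have h₄ : |a| ^ 2 = a ^ 2 := sq_abs a
  unfold den
  nlinarith [abs_nonneg a]

theorem den_pos (h : zx z p ^ 2 + zy z p ^ 2 < 1) : 0 < b.den z p :=
  lt_of_lt_of_le (by linarith) (b.half_le_den h)

theorem sq_add_sq_le_one (h : zx z p ^ 2 + zy z p ^ 2 < 1) : b.P z p ^ 2 + b.Q z p ^ 2 ≤ 1 := by
  have hd := b.den_pos h
  rw [P, Q, div_pow, div_pow, ← add_div, div_le_one (by positivity), den]
  have : (1 - b.s * (b.C * zx z p + b.S * zy z p)) ^ 2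
      - ((b.C * zx z p + b.S * zy z p - b.s) ^ 2 + (b.σ * (b.C * zy z p - b.S * zx z p)) ^ 2)
      = b.σ ^ 2 * (1 - (zx z p ^ 2 + zy z p ^ 2)) := by
    linear_combination
      (-1 + (b.C * zx z p + b.S * zy z p) ^ 2) * b.hyp
        - b.σ ^ 2 * (zx z p ^ 2 + zy z p ^ 2) * b.rot
  nlinarith [mul_nonneg (sq_nonneg b.σ) (sub_nonneg.2 h.le)]

variable {U : Set (ℝ × ℝ)}

theorem contDiffOn_slopes (hU : IsOpen U) (hz : ContDiffOn ℝ 2 z U)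
    (hgrad : ∀ p ∈ U, zx z p ^ 2 + zy z p ^ 2 < 1) :
    ContDiffOn ℝ 1 (b.P z) U ∧ ContDiffOn ℝ 1 (b.Q z) U := by
  have h : ContDiffOn ℝ 1 (zx z) U ∧ ContDiffOn ℝ 1 (zy z) U :=
    contDiffOn_pd (m := 1) (n := 2) hU hz (by norm_num)
  have hden : ContDiffOn ℝ 1 (b.den z) U :=
    contDiffOn_const.sub (contDiffOn_const.mul ((contDiffOn_const.mul h.1).add
      (contDiffOn_const.mul h.2)))
  have h0 : ∀ p ∈ U, b.den z p ≠ 0 := fun p hp => (b.den_pos (hgrad p hp)).ne'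
  exact ⟨(((contDiffOn_const.mul h.1).add (contDiffOn_const.mul h.2)).sub
      contDiffOn_const).div hden h0,
    (contDiffOn_const.mul ((contDiffOn_const.mul h.2).sub (contDiffOn_const.mul h.1))).div
      hden h0⟩

theorem contDiffOn_coords (hz : ContDiffOn ℝ 2 z U) (c : ℝ × ℝ) (z₀ δ : ℝ) :
    ContDiffOn ℝ 1 (b.X z c z₀ δ) U ∧ ContDiffOn ℝ 1 (b.Y c δ) U := by
  have h₁ : ContDiffOn ℝ 1 (fun p : ℝ × ℝ => b.C * (p.1 - c.1) + b.S * (p.2 - c.2)) U := by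
    fun_prop
  refine ⟨((h₁.sub (contDiffOn_const.mul ((hz.of_le (by norm_num)).sub
    contDiffOn_const))).div_const _), ?_⟩
  have : ContDiff ℝ 1 (b.Y c δ) := by unfold Y; fun_prop
  exact this.contDiffOn

theorem fderiv_slopes (h₁ : DifferentiableAt ℝ (zx z) p) (h₂ : DifferentiableAt ℝ (zy z) p)
    (hd : b.den z p ≠ 0) (w : ℝ × ℝ) :
    fderiv ℝ (b.P z) p w
        = b.σ ^ 2 * (b.C * fderiv ℝ (zx z) p w + b.S * fderiv ℝ (zy z) p w) / b.den z p ^ 2 ∧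
      fderiv ℝ (b.Q z) p w
        = b.σ * ((b.C * fderiv ℝ (zy z) p w - b.S * fderiv ℝ (zx z) p w) * b.den z p
          + b.s * (b.C * zy z p - b.S * zx z p)
            * (b.C * fderiv ℝ (zx z) p w + b.S * fderiv ℝ (zy z) p w)) / b.den z p ^ 2 := by
  have k₁ := h₁.hasFDerivAt
  have k₂ := h₂.hasFDerivAt
  have d₁ : HasFDerivAt (fun q => b.C * zx z q + b.S * zy z q) _ p :=
    (k₁.const_mul b.C).add (k₂.const_mul b.S)
  have d₂ : HasFDerivAt (fun q => b.C * zy z q - b.S * zx z q) _ p :=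
    (k₂.const_mul b.C).sub (k₁.const_mul b.S)
  have d₃ : HasFDerivAt (b.den z) _ p := (d₁.const_mul b.s).const_sub 1
  have di := (hasDerivAt_inv hd).comp_hasFDerivAt p d₃
  have dP := (d₁.sub_const b.s).fun_mul di
  have dQ := (d₂.const_mul b.σ).fun_mul di
  have eP : b.P z = fun q => (b.C * zx z q + b.S * zy z q - b.s) * (Inv.inv ∘ b.den z) q :=
    funext fun q => div_eq_mul_inv _ _
  have eQ : b.Q z = fun q => b.σ * (b.C * zy z q - b.S * zx z q) * (Inv.inv ∘ b.den z) q :=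
    funext fun q => div_eq_mul_inv _ _
  rw [eP, eQ, dP.fderiv, dQ.fderiv]
  constructor
  · simp only [smul_apply, add_apply, neg_apply, smul_eq_mul, Function.comp_apply, den] at hd ⊢
    field_simp
    linear_combination -(b.C * fderiv ℝ (zx z) p w + b.S * fderiv ℝ (zy z) p w)
      / (1 - b.s * (b.C * zx z p + b.S * zy z p)) ^ 2 * b.hyp
  · simp only [smul_apply, sub_apply,
      add_apply, neg_apply, smul_eq_mul, Function.comp_apply, den] at hd ⊢
    field_simp
    ring

theorem fderiv_coords (hz : DifferentiableAt ℝ z p) (c : ℝ × ℝ) (z₀ δ : ℝ) (w : ℝ × ℝ) :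
    fderiv ℝ (b.X z c z₀ δ) p w
        = (b.C * w.1 + b.S * w.2 - b.s * fderiv ℝ z p w) / (b.σ * δ) ∧
      fderiv ℝ (b.Y c δ) p w = (b.C * w.2 - b.S * w.1) / δ := by
  have k₁ : HasFDerivAt (fun q : ℝ × ℝ => q.1 - c.1) (ContinuousLinearMap.fst ℝ ℝ ℝ) p :=
    hasFDerivAt_fst.sub_const _
  have k₂ : HasFDerivAt (fun q : ℝ × ℝ => q.2 - c.2) (ContinuousLinearMap.snd ℝ ℝ ℝ) p :=
    hasFDerivAt_snd.sub_const _
  have dX := (((k₁.const_mul b.C).fun_add (k₂.const_mul b.S)).fun_sub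
    ((hz.hasFDerivAt.sub_const z₀).const_mul b.s)).mul_const (b.σ * δ)⁻¹
  have dY := ((k₂.const_mul b.C).fun_sub (k₁.const_mul b.S)).mul_const δ⁻¹
  have eX : b.X z c z₀ δ = fun q => (b.C * (q.1 - c.1) + b.S * (q.2 - c.2) - b.s * (z q - z₀))
      * (b.σ * δ)⁻¹ := funext fun q => div_eq_mul_inv _ _
  have eY : b.Y c δ = fun q => (b.C * (q.2 - c.2) - b.S * (q.1 - c.1)) * δ⁻¹ :=
    funext fun q => div_eq_mul_inv _ _
  rw [eX, eY, dX.fderiv, dY.fderiv]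
  constructor <;>
  · simp only [smul_apply, sub_apply,
      add_apply, smul_eq_mul, ContinuousLinearMap.coe_fst',
      ContinuousLinearMap.coe_snd']
    ring

theorem jac_slopes (hU : IsOpen U) (hz : ContDiffOn ℝ 2 z U)
    (hgrad : ∀ p ∈ U, zx z p ^ 2 + zy z p ^ 2 < 1) (hp : p ∈ U) :
    jac (b.P z) (b.Q z) p = b.σ ^ 3 / b.den z p ^ 3 * hessDet z p := by
  have h : ContDiffOn ℝ 1 (zx z) U ∧ ContDiffOn ℝ 1 (zy z) U :=
    contDiffOn_pd (m := 1) (n := 2) hU hz (by norm_num)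
  have h₁ := (h.1.contDiffAt (hU.mem_nhds hp)).differentiableAt one_ne_zero
  have h₂ := (h.2.contDiffAt (hU.mem_nhds hp)).differentiableAt one_ne_zero
  have hd := (b.den_pos (hgrad p hp)).ne'
  have hs : pd1 (zy z) p = pd2 (zx z) p := pd_comm (hz.contDiffAt (hU.mem_nhds hp))
  have F := b.fderiv_slopes h₁ h₂ hd
  simp only [jac, hessDet, zxx, zxy, zyy, pd1, pd2, F] at hs ⊢
  rw [hs]
  field_simp
  linear_combination b.σ ^ 3 * b.den z p * (fderiv ℝ (zx z) p (1, 0) * fderiv ℝ (zy z) p (0, 1)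
    - fderiv ℝ (zx z) p (0, 1) ^ 2) * b.rot

theorem jac_add_jac_eq_zero (hU : IsOpen U) (hz : ContDiffOn ℝ 2 z U)
    (hgrad : ∀ p ∈ U, zx z p ^ 2 + zy z p ^ 2 < 1) (hp : p ∈ U) (c : ℝ × ℝ) (z₀ : ℝ) {δ : ℝ}
    (hδ : 0 < δ) :
    jac (b.P z) (b.X z c z₀ δ) p + jac (b.Q z) (b.Y c δ) p = 0 := by
  have h : ContDiffOn ℝ 1 (zx z) U ∧ ContDiffOn ℝ 1 (zy z) U :=
    contDiffOn_pd (m := 1) (n := 2) hU hz (by norm_num)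
  have h₁ := (h.1.contDiffAt (hU.mem_nhds hp)).differentiableAt one_ne_zero
  have h₂ := (h.2.contDiffAt (hU.mem_nhds hp)).differentiableAt one_ne_zero
  have hd := (b.den_pos (hgrad p hp)).ne'
  have hs : pd1 (zy z) p = pd2 (zx z) p := pd_comm (hz.contDiffAt (hU.mem_nhds hp))
  have F := b.fderiv_slopes h₁ h₂ hd
  have G := b.fderiv_coords ((hz.contDiffAt (hU.mem_nhds hp)).differentiableAt two_ne_zero)
    c z₀ δ
  have e₁ : fderiv ℝ z p (1, 0) = zx z p := rfl
  have e₂ : fderiv ℝ z p (0, 1) = zy z p := rfl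
  have hσ := b.σ_pos.ne'
  simp only [jac, pd1, pd2, F, G, e₁, e₂] at hs ⊢
  rw [hs]
  simp only [den] at hd ⊢
  field_simp
  linear_combination b.σ * b.s *
    ((b.C * fderiv ℝ (zx z) p (1, 0) + b.S * fderiv ℝ (zx z) p (0, 1)) * zy z p
    - (b.C * fderiv ℝ (zx z) p (0, 1) + b.S * fderiv ℝ (zy z) p (0, 1)) * zx z p) * b.rot

end Boost

/-- A smooth cutoff around `c`, equal to one at distance at most `r` and vanishing at distance at
least `2 * r`. -/
def bump (c : ℝ × ℝ) {r : ℝ} (hr : 0 < r) : ContDiffBump c where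
  rIn := r
  rOut := 2 * r
  rIn_pos := hr
  rIn_lt_rOut := by linarith

theorem pd_bump_eq_zero {c : ℝ × ℝ} {r : ℝ} (hr : 0 < r) {p : ℝ × ℝ}
    (hp : p ∈ ball c r ∨ p ∉ closedBall c (2 * r)) :
    pd1 (bump c hr) p = 0 ∧ pd2 (bump c hr) p = 0 := by
  rcases hp with hp | hp
  · exact pd_eq_zero_of_eq_const isOpen_ball
      (fun q hq => (bump c hr).one_of_mem_closedBall (ball_subset_closedBall hq)) hp
  · exact pd_eq_zero_of_eq_const isClosed_closedBall.isOpen_compl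
      (fun q hq => (bump c hr).zero_of_le_dist
        (not_le.1 fun h => hq (mem_closedBall.2 h)).le) hp

theorem abs_sub_le_ed_fst (p c : ℝ × ℝ) : |p.1 - c.1| ≤ ed p c ∧ |p.2 - c.2| ≤ ed p c := by
  have h := ed_sq p c
  constructor <;>
  · apply abs_le_of_sq_le_sq _ (ed_nonneg _ _)
    nlinarith [sq_nonneg (p.1 - c.1), sq_nonneg (p.2 - c.2)]

theorem dist_le_ed (p c : ℝ × ℝ) : dist p c ≤ ed p c := by
  rw [Prod.dist_eq, Real.dist_eq, Real.dist_eq]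
  exact max_le (abs_sub_le_ed_fst p c).1 (abs_sub_le_ed_fst p c).2

theorem ed_le_two_mul_dist (p c : ℝ × ℝ) : ed p c ≤ 2 * dist p c := by
  have h₁ : |p.1 - c.1| ≤ dist p c := by rw [Prod.dist_eq, Real.dist_eq]; exact le_max_left _ _
  have h₂ : |p.2 - c.2| ≤ dist p c := by
    rw [Prod.dist_eq, Real.dist_eq, Real.dist_eq]; exact le_max_right _ _
  refine le_trans ?_ (by linarith : |p.1 - c.1| + |p.2 - c.2| ≤ 2 * dist p c)
  apply le_of_sq_le_sq _ (by positivity)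
  rw [ed_sq, add_sq, sq_abs, sq_abs]
  nlinarith [mul_nonneg (abs_nonneg (p.1 - c.1)) (abs_nonneg (p.2 - c.2))]

theorem closedBall_sdiff_subset_pdisk {x₀ y₀ r t : ℝ} (hr : 0 < r) (ht : 0 < t) :
    closedBall ((x₀, y₀) : ℝ × ℝ) (2 * r) \ ball (x₀, y₀) t ⊆ PDisk x₀ y₀ (4 * r) := by
  rintro p ⟨hp₁, hp₂⟩
  have h₁ := mem_closedBall.1 hp₁
  rw [Prod.dist_eq, max_le_iff, Real.dist_eq, Real.dist_eq] at h₁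
  have h₂ : t ≤ dist p (x₀, y₀) := not_lt.1 hp₂
  refine ⟨?_, ?_⟩
  · rw [← ed_sq p (x₀, y₀)]
    have := dist_le_ed p (x₀, y₀)
    have : 0 < ed p (x₀, y₀) := by linarith
    positivity
  · nlinarith [sq_le_sq' (abs_le.1 h₁.1).1 (abs_le.1 h₁.1).2,
      sq_le_sq' (abs_le.1 h₁.2).1 (abs_le.1 h₁.2).2]

namespace Boost

variable (b : Boost) {z : ℝ × ℝ → ℝ} {p c : ℝ × ℝ} {z₀ δ : ℝ}

theorem σ_le_one : b.σ ≤ 1 := by nlinarith [b.hyp, b.σ_pos, sq_nonneg b.s]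

theorem abs_combination_le (p c : ℝ × ℝ) :
    |b.C * (p.1 - c.1) + b.S * (p.2 - c.2)| ≤ ed p c ∧
      |b.C * (p.2 - c.2) - b.S * (p.1 - c.1)| ≤ ed p c := by
  have h := ed_sq p c
  have e : (b.C * (p.1 - c.1) + b.S * (p.2 - c.2)) ^ 2
      + (b.C * (p.2 - c.2) - b.S * (p.1 - c.1)) ^ 2 = ed p c ^ 2 := by
    rw [h]; linear_combination ((p.1 - c.1) ^ 2 + (p.2 - c.2) ^ 2) * b.rot
  constructor <;>
  · apply abs_le_of_sq_le_sq _ (ed_nonneg _ _)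
    nlinarith [sq_nonneg (b.C * (p.1 - c.1) + b.S * (p.2 - c.2)),
      sq_nonneg (b.C * (p.2 - c.2) - b.S * (p.1 - c.1))]

theorem ed_le_of_norm_coords_le (hδ : 0 < δ) (h : |z p - z₀| ≤ ed p c) {m : ℝ}
    (hm : ‖(b.X z c z₀ δ p, b.Y c δ p)‖ ≤ m) : (1 - b.s) * ed p c ≤ 2 * m * δ := by
  have hσ := b.σ_pos
  rw [Prod.norm_mk, max_le_iff, Real.norm_eq_abs, Real.norm_eq_abs, X, Y, abs_div, abs_div,
    abs_of_pos hδ, abs_of_pos (mul_pos hσ hδ), div_le_iff₀ hδ, div_le_iff₀ (mul_pos hσ hδ)] at hm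
  set A := b.C * (p.1 - c.1) + b.S * (p.2 - c.2) with hA
  set B := b.C * (p.2 - c.2) - b.S * (p.1 - c.1) with hB
  have e : |A| ^ 2 + |B| ^ 2 = ed p c ^ 2 := by
    rw [ed_sq, hA, hB, sq_abs, sq_abs]
    linear_combination ((p.1 - c.1) ^ 2 + (p.2 - c.2) ^ 2) * b.rot
  have h₁ : ed p c ≤ |A| + |B| := by
    apply le_of_sq_le_sq _ (by positivity)
    nlinarith [mul_nonneg (abs_nonneg A) (abs_nonneg B)]
  have h₂ : |A| ≤ |A - b.s * (z p - z₀)| + b.s * |z p - z₀| := by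
    have := abs_add_le (A - b.s * (z p - z₀)) (b.s * (z p - z₀))
    rwa [sub_add_cancel, abs_mul b.s, abs_of_nonneg b.s_nonneg] at this
  have h₃ := mul_le_mul_of_nonneg_left h b.s_nonneg
  have hm0 : 0 ≤ m * δ := (abs_nonneg _).trans hm.2
  have h₄ : m * (b.σ * δ) ≤ m * δ := by
    have := mul_le_of_le_one_right hm0 b.σ_le_one
    nlinarith
  linarith [hm.1, hm.2]

theorem norm_coords_lt_one (hδ : 0 < δ) (h : |z p - z₀| ≤ ed p c)
    (hp : dist p c < b.σ * δ / 4) : ‖(b.X z c z₀ δ p, b.Y c δ p)‖ < 1 := by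
  have hσ := b.σ_pos
  have hn := ed_le_two_mul_dist p c
  have hc := b.abs_combination_le p c
  rw [Prod.norm_mk, max_lt_iff, Real.norm_eq_abs, Real.norm_eq_abs, X, Y, abs_div, abs_div,
    abs_of_pos hδ, abs_of_pos (mul_pos hσ hδ), div_lt_iff₀ hδ, div_lt_iff₀ (mul_pos hσ hδ)]
  constructor
  · have h₂ := abs_sub (b.C * (p.1 - c.1) + b.S * (p.2 - c.2)) (b.s * (z p - z₀))
    rw [abs_mul b.s, abs_of_nonneg b.s_nonneg] at h₂
    have h₃ : b.s * |z p - z₀| ≤ ed p c :=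
      (mul_le_of_le_one_left (abs_nonneg _) b.s_lt_one.le).trans h
    linarith
  · have : b.σ * δ ≤ δ := mul_le_of_le_one_left hδ.le b.σ_le_one
    linarith [hc.2]

theorem injOn_coords {U : Set (ℝ × ℝ)} (hδ : 0 < δ)
    (hLip : ∀ p ∈ U, ∀ q ∈ U, |z q - z p| ≤ ed q p) :
    InjOn (fun p => (b.X z c z₀ δ p, b.Y c δ p)) U := by
  intro p hp q hq h
  have hσ := b.σ_pos
  have h₁ : b.X z c z₀ δ p = b.X z c z₀ δ q := congrArg Prod.fst h
  have h₂ : b.Y c δ p = b.Y c δ q := congrArg Prod.snd h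
  rw [X, X, div_left_inj' (mul_pos hσ hδ).ne'] at h₁
  rw [Y, Y, div_left_inj' hδ.ne'] at h₂
  have h₃ := hLip p hp q hq
  have h₄ : (z q - z p) ^ 2 ≤ ed q p ^ 2 := sq_le_sq' (abs_le.1 h₃).1 (abs_le.1 h₃).2
  have e : ed q p ^ 2 = (b.s * (z q - z p)) ^ 2 := by
    have a₁ : b.C * (q.1 - p.1) + b.S * (q.2 - p.2) = b.s * (z q - z p) := by
      linear_combination -h₁
    have a₂ : b.C * (q.2 - p.2) - b.S * (q.1 - p.1) = 0 := by linear_combination -h₂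
    rw [ed_sq, ← a₁]
    linear_combination (-(q.1 - p.1) ^ 2 - (q.2 - p.2) ^ 2) * b.rot
      + (b.C * (q.2 - p.2) - b.S * (q.1 - p.1)) * a₂
  have h₅ : b.σ ^ 2 * ed q p ^ 2 ≤ 0 := by
    have := b.hyp
    have : b.σ ^ 2 * ed q p ^ 2 = ed q p ^ 2 - b.s ^ 2 * ed q p ^ 2 := by
      linear_combination ed q p ^ 2 * b.hyp
    have := mul_le_mul_of_nonneg_left h₄ (sq_nonneg b.s)
    nlinarith
  have h₆ : ed q p ^ 2 = 0 := by
    have : 0 < b.σ ^ 2 := by positivity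
    nlinarith [sq_nonneg (ed q p)]
  rw [ed_sq] at h₆
  ext <;> nlinarith [sq_nonneg (q.1 - p.1), sq_nonneg (q.2 - p.2)]

/-- The cutoff equal to `1` near but not at the center, in boosted coordinates near the center. -/
def cutoff (z : ℝ × ℝ → ℝ) (c : ℝ × ℝ) (z₀ : ℝ) {r : ℝ} (hr : 0 < r) (δ : ℝ) (p : ℝ × ℝ) : ℝ :=
  bump c hr p - bump 0 one_pos (b.X z c z₀ δ p, b.Y c δ p)

theorem cutoff_nonneg {r : ℝ} (hr : 0 < r) (hδ : 0 < δ) (h : |z p - z₀| ≤ ed p c)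
    (hδr : 4 * δ ≤ (1 - b.s) * r) : 0 ≤ b.cutoff z c z₀ hr δ p := by
  unfold cutoff
  by_cases hT : ‖(b.X z c z₀ δ p, b.Y c δ p)‖ ≤ 2
  · have h₁ := b.ed_le_of_norm_coords_le hδ h hT
    have h₂ : ed p c ≤ r :=
      le_of_mul_le_mul_left (by linarith) (sub_pos.2 b.s_lt_one)
    rw [(bump c hr).one_of_mem_closedBall ((dist_le_ed p c).trans h₂)]
    exact sub_nonneg.2 (ContDiffBump.le_one _)
  · rw [(bump 0 one_pos).zero_of_le_dist, sub_zero]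
    · exact ContDiffBump.nonneg _
    · rw [dist_zero_right]
      exact (mul_one (2 : ℝ)).le.trans (not_le.1 hT).le

theorem eventually_cutoff_eq {r : ℝ} (hr : 0 < r) (h : |z p - z₀| ≤ ed p c) (hp : 0 < ed p c) :
    ∀ᶠ δ in nhdsWithin (0 : ℝ) (Ioi 0), b.cutoff z c z₀ hr δ p = bump c hr p := by
  have hpos : 0 < (1 - b.s) * ed p c / 4 := by
    have := sub_pos.2 b.s_lt_one
    positivity
  filter_upwards [Ioo_mem_nhdsGT hpos] with δ hδ
  have : ¬ ‖(b.X z c z₀ δ p, b.Y c δ p)‖ ≤ 2 := fun hT => by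
    have := b.ed_le_of_norm_coords_le hδ.1 h hT
    linarith [hδ.2]
  rw [cutoff, (bump 0 one_pos).zero_of_le_dist, sub_zero]
  rw [dist_zero_right]
  exact (mul_one (2 : ℝ)).le.trans (not_le.1 this).le

theorem cutoff_eq_zero {r : ℝ} (hr : 0 < r) (hδ : 0 < δ) (h : |z p - z₀| ≤ ed p c)
    (hδr : 4 * δ ≤ (1 - b.s) * r)
    (hp : p ∉ closedBall c (2 * r) \ ball c (b.σ * δ / 4)) :
    b.cutoff z c z₀ hr δ p = 0 ∧ pd1 (bump 0 one_pos) (b.X z c z₀ δ p, b.Y c δ p) = 0 ∧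
      pd2 (bump 0 one_pos) (b.X z c z₀ δ p, b.Y c δ p) = 0 := by
  by_cases hp' : p ∈ ball c (b.σ * δ / 4)
  · have hT := b.norm_coords_lt_one hδ h hp'
    have hT' : (b.X z c z₀ δ p, b.Y c δ p) ∈ ball (0 : ℝ × ℝ) 1 := by
      rwa [mem_ball_zero_iff]
    refine ⟨?_, pd_bump_eq_zero one_pos (Or.inl hT')⟩
    have hr' : b.σ * δ / 4 ≤ r := by
      have h₁ := mul_le_of_le_one_left hδ.le b.σ_le_one
      have h₂ := mul_le_of_le_one_left hr.le (by linarith [b.s_nonneg] : 1 - b.s ≤ 1)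
      linarith
    rw [cutoff, (bump 0 one_pos).one_of_mem_closedBall (ball_subset_closedBall hT'),
      (bump c hr).one_of_mem_closedBall ((mem_ball.1 hp').le.trans hr'), sub_self]
  · have hp₂ : 2 * r < dist p c := not_le.1 fun h => hp ⟨h, hp'⟩
    have hT : ¬ ‖(b.X z c z₀ δ p, b.Y c δ p)‖ ≤ 2 := fun hT => by
      have h₁ := b.ed_le_of_norm_coords_le hδ h hT
      have h₂ : ed p c ≤ r :=
        le_of_mul_le_mul_left (by linarith) (sub_pos.2 b.s_lt_one)
      linarith [dist_le_ed p c]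
    have hT' : (b.X z c z₀ δ p, b.Y c δ p) ∉ closedBall (0 : ℝ × ℝ) (2 * 1) := by
      rwa [mem_closedBall_zero_iff, mul_one]
    refine ⟨?_, pd_bump_eq_zero one_pos (Or.inr hT')⟩
    rw [cutoff, (bump 0 one_pos).zero_of_le_dist, (bump c hr).zero_of_le_dist hp₂.le, sub_self]
    exact (not_le.1 hT').le

end Boost

/-- A bound, uniform over all boosts, for the contribution of the outer cutoff `η`. -/
def outerBound (z η : ℝ × ℝ → ℝ) (p : ℝ × ℝ) : ℝ :=
  (|pd1 η p| + |pd2 η p|) * ((|zxx z p| + |zxy z p| + |zyy z p|)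
    * (((1 - zx z p ^ 2 - zy z p ^ 2) / 2)⁻¹ + (((1 - zx z p ^ 2 - zy z p ^ 2) / 2) ^ 2)⁻¹))

theorem integrableOn_outerBound {x₀ y₀ r : ℝ} (hr : 0 < r) {z : ℝ × ℝ → ℝ}
    (hz : ContDiffOn ℝ 2 z (PDisk x₀ y₀ (4 * r)))
    (hgrad : ∀ p ∈ PDisk x₀ y₀ (4 * r), zx z p ^ 2 + zy z p ^ 2 < 1) :
    IntegrableOn (outerBound z (bump (x₀, y₀) hr)) (PDisk x₀ y₀ (4 * r)) := by
  have hU := isOpen_pdisk x₀ y₀ (4 * r)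
  have h : ContDiffOn ℝ 1 (zx z) (PDisk x₀ y₀ (4 * r)) ∧
      ContDiffOn ℝ 1 (zy z) (PDisk x₀ y₀ (4 * r)) :=
    contDiffOn_pd (m := 1) (n := 2) hU hz (by norm_num)
  have hx := contDiffOn_pd (m := 0) (n := 1) hU h.1 (by norm_num)
  have hy := contDiffOn_pd (m := 0) (n := 1) hU h.2 (by norm_num)
  have hη : ContDiffOn ℝ 0 (pd1 (bump (x₀, y₀) hr)) univ ∧
      ContDiffOn ℝ 0 (pd2 (bump (x₀, y₀) hr)) univ :=
    contDiffOn_pd (m := 0) (n := 1) isOpen_univ (bump (x₀, y₀) hr).contDiff.contDiffOn (by norm_num)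
  have hk : ContinuousOn (fun p => (1 - zx z p ^ 2 - zy z p ^ 2) / 2) (PDisk x₀ y₀ (4 * r)) :=
    ((continuousOn_const.sub (h.1.continuousOn.pow 2)).sub (h.2.continuousOn.pow 2)).div_const 2
  have hk0 : ∀ p ∈ PDisk x₀ y₀ (4 * r), (1 - zx z p ^ 2 - zy z p ^ 2) / 2 ≠ 0 := fun p hp => by
    have := hgrad p hp
    linarith
  refine integrableOn_of_eq_zero hU ((isCompact_closedBall _ _).diff isOpen_ball)
    (closedBall_sdiff_subset_pdisk hr hr) ?_ ?_
  · refine ContinuousOn.mul ?_ (ContinuousOn.mul ?_ ?_)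
    · exact (hη.1.continuousOn.mono (subset_univ _)).abs.add
        (hη.2.continuousOn.mono (subset_univ _)).abs
    · exact (hx.1.continuousOn.abs.add hx.2.continuousOn.abs).add hy.2.continuousOn.abs
    · exact (hk.inv₀ hk0).add ((hk.pow 2).inv₀ fun p hp => pow_ne_zero 2 (hk0 p hp))
  · intro p hp hpK
    have : p ∈ ball (x₀, y₀) r ∨ p ∉ closedBall (x₀, y₀) (2 * r) := by
      by_contra! hcon
      exact hpK ⟨hcon.2, hcon.1⟩
    have := pd_bump_eq_zero hr this
    simp [outerBound, this.1, this.2]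

theorem abs_combination_le_of_abs_le_one {C S A B : ℝ} (h : C ^ 2 + S ^ 2 = 1) :
    |C * A + S * B| ≤ |A| + |B| := by
  have hC : |C| ≤ 1 := by rw [← sq_le_one_iff_abs_le_one]; nlinarith [sq_nonneg S]
  have hS : |S| ≤ 1 := by rw [← sq_le_one_iff_abs_le_one]; nlinarith [sq_nonneg C]
  refine (abs_add_le _ _).trans (add_le_add ?_ ?_)
  · rw [abs_mul]; exact mul_le_of_le_one_left (abs_nonneg _) hC
  · rw [abs_mul]; exact mul_le_of_le_one_left (abs_nonneg _) hS

namespace Boost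

variable (b : Boost) {z : ℝ × ℝ → ℝ} {U : Set (ℝ × ℝ)} {p : ℝ × ℝ}

theorem abs_fderiv_Q_le {f g k H d : ℝ} (hk : 0 < k) (hkd : k ≤ d)
    (hf : |b.C * g - b.S * f| ≤ H) (hg : |b.C * f + b.S * g| ≤ H) {a : ℝ} (ha : |a| ≤ 1) :
    |b.σ * ((b.C * g - b.S * f) * d + b.s * a * (b.C * f + b.S * g)) / d ^ 2|
      ≤ H * (k⁻¹ + (k ^ 2)⁻¹) := by
  have hd : 0 < d := hk.trans_le hkd
  have hH : 0 ≤ H := (abs_nonneg _).trans hf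
  have h₁ : |b.σ * ((b.C * g - b.S * f) * d + b.s * a * (b.C * f + b.S * g))| ≤ H * d + H := by
    rw [abs_mul, abs_of_pos b.σ_pos]
    refine (mul_le_of_le_one_left (abs_nonneg _) b.σ_le_one).trans ?_
    refine (abs_add_le _ _).trans (add_le_add ?_ ?_)
    · rw [abs_mul, abs_of_pos hd]; gcongr
    · rw [abs_mul, abs_mul, abs_of_nonneg b.s_nonneg]
      refine (mul_le_of_le_one_left (abs_nonneg _) ?_).trans hg
      exact mul_le_one₀ b.s_lt_one.le (abs_nonneg _) ha
  rw [abs_div, abs_of_pos (pow_pos hd 2)]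
  calc _ ≤ (H * d + H) / d ^ 2 := by gcongr
    _ = H * (d⁻¹ + (d ^ 2)⁻¹) := by field_simp
    _ ≤ _ := by gcongr

theorem abs_mul_jac_le (hU : IsOpen U) (hz : ContDiffOn ℝ 2 z U)
    (hgrad : ∀ p ∈ U, zx z p ^ 2 + zy z p ^ 2 < 1) (hp : p ∈ U) (η : ℝ × ℝ → ℝ) :
    |b.P z p * jac η (b.Q z) p| ≤ outerBound z η p := by
  have h : ContDiffOn ℝ 1 (zx z) U ∧ ContDiffOn ℝ 1 (zy z) U :=
    contDiffOn_pd (m := 1) (n := 2) hU hz (by norm_num)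
  have h₁ := (h.1.contDiffAt (hU.mem_nhds hp)).differentiableAt one_ne_zero
  have h₂ := (h.2.contDiffAt (hU.mem_nhds hp)).differentiableAt one_ne_zero
  have hs : pd1 (zy z) p = pd2 (zx z) p := pd_comm (hz.contDiffAt (hU.mem_nhds hp))
  have F := b.fderiv_slopes h₁ h₂ (b.den_pos (hgrad p hp)).ne'
  have hP : |b.P z p| ≤ 1 := by
    rw [← sq_le_one_iff_abs_le_one]
    nlinarith [b.sq_add_sq_le_one (hgrad p hp), sq_nonneg (b.Q z p)]
  have hk : 0 < (1 - zx z p ^ 2 - zy z p ^ 2) / 2 := by linarith [hgrad p hp]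
  have ha : |b.C * zy z p - b.S * zx z p| ≤ 1 := by
    rw [← sq_le_one_iff_abs_le_one]
    have e : (b.C * zy z p - b.S * zx z p) ^ 2 + (b.C * zx z p + b.S * zy z p) ^ 2
      = zx z p ^ 2 + zy z p ^ 2 := by
      linear_combination (zx z p ^ 2 + zy z p ^ 2) * b.rot
    nlinarith [sq_nonneg (b.C * zx z p + b.S * zy z p), hgrad p hp]
  have n₁ (A B : ℝ) : |b.C * A - b.S * B| ≤ |A| + |B| := by
    have := abs_combination_le_of_abs_le_one (A := A) (B := -B) b.rot
    rwa [abs_neg, mul_neg, ← sub_eq_add_neg] at this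
  have n₂ (A B : ℝ) : |b.C * A + b.S * B| ≤ |A| + |B| := abs_combination_le_of_abs_le_one b.rot
  have q₁ : |pd1 (b.Q z) p| ≤ (|zxx z p| + |zxy z p| + |zyy z p|)
      * (((1 - zx z p ^ 2 - zy z p ^ 2) / 2)⁻¹
        + (((1 - zx z p ^ 2 - zy z p ^ 2) / 2) ^ 2)⁻¹) := by
    rw [pd1, (F (1, 0)).2]
    have e₁ : fderiv ℝ (zx z) p (1, 0) = zxx z p := rfl
    have e₂ : fderiv ℝ (zy z) p (1, 0) = zxy z p := hs
    rw [e₁, e₂]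
    refine b.abs_fderiv_Q_le hk (b.half_le_den (hgrad p hp)) ?_ ?_ ha
    · linarith [n₁ (zxy z p) (zxx z p), abs_nonneg (zyy z p)]
    · linarith [n₂ (zxx z p) (zxy z p), abs_nonneg (zyy z p)]
  have q₂ : |pd2 (b.Q z) p| ≤ (|zxx z p| + |zxy z p| + |zyy z p|)
      * (((1 - zx z p ^ 2 - zy z p ^ 2) / 2)⁻¹
        + (((1 - zx z p ^ 2 - zy z p ^ 2) / 2) ^ 2)⁻¹) := by
    rw [pd2, (F (0, 1)).2]
    have e₁ : fderiv ℝ (zx z) p (0, 1) = zxy z p := rfl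
    have e₂ : fderiv ℝ (zy z) p (0, 1) = zyy z p := rfl
    rw [e₁, e₂]
    refine b.abs_fderiv_Q_le hk (b.half_le_den (hgrad p hp)) ?_ ?_ ha
    · linarith [n₁ (zyy z p) (zxy z p), abs_nonneg (zxx z p)]
    · linarith [n₂ (zxy z p) (zyy z p), abs_nonneg (zxx z p)]
  rw [abs_mul]
  refine (mul_le_of_le_one_left (abs_nonneg _) hP).trans ?_
  unfold jac outerBound
  refine (abs_sub _ _).trans ?_
  rw [abs_mul, abs_mul, add_mul]
  exact add_le_add (mul_le_mul_of_nonneg_left q₂ (abs_nonneg _))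
    (mul_le_mul_of_nonneg_left q₁ (abs_nonneg _))

variable {x₀ y₀ r z₀ δ : ℝ}

theorem contDiffOn_cutoff (hr : 0 < r) (hz : ContDiffOn ℝ 2 z U) (c : ℝ × ℝ) :
    ContDiffOn ℝ 1 (b.cutoff z c z₀ hr δ) U := by
  have h := b.contDiffOn_coords hz c z₀ δ
  exact (bump c hr).contDiff.contDiffOn.sub
    ((bump 0 one_pos).contDiff.comp_contDiffOn (h.1.prodMk h.2))

theorem abs_integral_cutoff_le (hr : 0 < r) (hz : ContDiffOn ℝ 2 z (PDisk x₀ y₀ (4 * r)))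
    (hgrad : ∀ p ∈ PDisk x₀ y₀ (4 * r), zx z p ^ 2 + zy z p ^ 2 < 1)
    (hLip : ∀ p ∈ PDisk x₀ y₀ (4 * r), ∀ q ∈ PDisk x₀ y₀ (4 * r), |z q - z p| ≤ ed q p)
    (hz₀ : ∀ p ∈ PDisk x₀ y₀ (4 * r), |z p - z₀| ≤ ed p (x₀, y₀))
    (hδ : 0 < δ) (hδr : 4 * δ ≤ (1 - b.s) * r) :
    |∫ p in PDisk x₀ y₀ (4 * r), b.cutoff z (x₀, y₀) z₀ hr δ p * jac (b.P z) (b.Q z) p|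
      ≤ (∫ p in PDisk x₀ y₀ (4 * r), outerBound z (bump (x₀, y₀) hr) p)
        + ∫ p, hessBound (bump 0 one_pos) p := by
  have hU := isOpen_pdisk x₀ y₀ (4 * r)
  have hs := b.contDiffOn_slopes hU hz hgrad
  have hc := b.contDiffOn_coords hz (x₀, y₀) z₀ δ
  have hσδ : 0 < b.σ * δ / 4 := by have := b.σ_pos; positivity
  have h0 : ∀ p ∈ PDisk x₀ y₀ (4 * r),
      p ∉ closedBall (x₀, y₀) (2 * r) \ ball (x₀, y₀) (b.σ * δ / 4) → _ :=
    fun p hp hpK => b.cutoff_eq_zero hr hδ (hz₀ p hp) hδr hpK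
  refine (integral_cutoff_mul_jac_le hU ((isCompact_closedBall (x₀, y₀) (2 * r)).diff isOpen_ball)
    (closedBall_sdiff_subset_pdisk hr hσδ) hc.1 hc.2 hs.1 hs.2 (bump (x₀, y₀) hr).contDiff
    (bump 0 one_pos).contDiff (bump 0 one_pos).hasCompactSupport
    (fun p hp => b.jac_add_jac_eq_zero hU hz hgrad hp _ _ hδ)
    (fun p hp => b.sq_add_sq_le_one (hgrad p hp)) (b.injOn_coords hδ hLip)
    (fun p hp hpK => (h0 p hp hpK).1) (fun p hp hpK => (h0 p hp hpK).2)).trans ?_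
  refine add_le_add_left (integral_mono_of_nonneg (Eventually.of_forall fun p => abs_nonneg _)
    (integrableOn_outerBound hr hz hgrad) ?_) _
  filter_upwards [ae_restrict_mem hU.measurableSet] with p hp
  exact b.abs_mul_jac_le hU hz hgrad hp _

end Boost

namespace Boost

variable (b : Boost) {z : ℝ × ℝ → ℝ} {x₀ y₀ r z₀ δ : ℝ}

theorem lintegral_cutoff_le (hr : 0 < r) (hz : ContDiffOn ℝ 2 z (PDisk x₀ y₀ (4 * r)))
    (hgrad : ∀ p ∈ PDisk x₀ y₀ (4 * r), zx z p ^ 2 + zy z p ^ 2 < 1)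
    (hLip : ∀ p ∈ PDisk x₀ y₀ (4 * r), ∀ q ∈ PDisk x₀ y₀ (4 * r), |z q - z p| ≤ ed q p)
    (hz₀ : ∀ p ∈ PDisk x₀ y₀ (4 * r), |z p - z₀| ≤ ed p (x₀, y₀)) {ε : ℝ} (hε : |ε| = 1)
    (hsign : ∀ p ∈ PDisk x₀ y₀ (4 * r), |hessDet z p| = ε * hessDet z p)
    (hδ : 0 < δ) (hδr : 4 * δ ≤ (1 - b.s) * r) :
    ∫⁻ p in PDisk x₀ y₀ (4 * r), ENNReal.ofReal
        (b.cutoff z (x₀, y₀) z₀ hr δ p * (b.σ ^ 3 / b.den z p ^ 3 * |hessDet z p|))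
      ≤ ENNReal.ofReal ((∫ p in PDisk x₀ y₀ (4 * r), outerBound z (bump (x₀, y₀) hr) p)
        + ∫ p, hessBound (bump 0 one_pos) p) := by
  have hU := isOpen_pdisk x₀ y₀ (4 * r)
  have hs := b.contDiffOn_slopes hU hz hgrad
  have hσδ : 0 < b.σ * δ / 4 := by have := b.σ_pos; positivity
  have hI : IntegrableOn (fun p => b.cutoff z (x₀, y₀) z₀ hr δ p * jac (b.P z) (b.Q z) p)
      (PDisk x₀ y₀ (4 * r)) :=
    integrableOn_of_eq_zero hU ((isCompact_closedBall (x₀, y₀) (2 * r)).diff isOpen_ball)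
      (closedBall_sdiff_subset_pdisk hr hσδ)
      ((b.contDiffOn_cutoff hr hz _).continuousOn.mul (continuousOn_jac hU hs.1 hs.2))
      (fun p hp hpK => by rw [(b.cutoff_eq_zero hr hδ (hz₀ p hp) hδr hpK).1, zero_mul])
  have e : ∀ p ∈ PDisk x₀ y₀ (4 * r),
      b.cutoff z (x₀, y₀) z₀ hr δ p * (b.σ ^ 3 / b.den z p ^ 3 * |hessDet z p|)
        = ε * (b.cutoff z (x₀, y₀) z₀ hr δ p * jac (b.P z) (b.Q z) p) := by
    intro p hp
    rw [b.jac_slopes hU hz hgrad hp, hsign p hp]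
    ring
  have hnn : ∀ p ∈ PDisk x₀ y₀ (4 * r),
      0 ≤ ε * (b.cutoff z (x₀, y₀) z₀ hr δ p * jac (b.P z) (b.Q z) p) := by
    intro p hp
    rw [← e p hp]
    have := b.cutoff_nonneg hr hδ (hz₀ p hp) hδr
    have := b.den_pos (hgrad p hp)
    have := b.σ_pos
    positivity
  rw [setLIntegral_congr_fun hU.measurableSet fun p hp => congrArg ENNReal.ofReal (e p hp),
    ← ofReal_integral_eq_lintegral_ofReal (hI.const_mul ε)
      ((ae_restrict_mem hU.measurableSet).mono hnn), integral_const_mul]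
  refine ENNReal.ofReal_le_ofReal ((le_abs_self _).trans ?_)
  rw [abs_mul, hε, one_mul]
  exact b.abs_integral_cutoff_le hr hz hgrad hLip hz₀ hδ hδr

theorem lintegral_bump_le (hr : 0 < r) (hz : ContDiffOn ℝ 2 z (PDisk x₀ y₀ (4 * r)))
    (hgrad : ∀ p ∈ PDisk x₀ y₀ (4 * r), zx z p ^ 2 + zy z p ^ 2 < 1)
    (hLip : ∀ p ∈ PDisk x₀ y₀ (4 * r), ∀ q ∈ PDisk x₀ y₀ (4 * r), |z q - z p| ≤ ed q p)
    (hz₀ : ∀ p ∈ PDisk x₀ y₀ (4 * r), |z p - z₀| ≤ ed p (x₀, y₀)) {ε : ℝ} (hε : |ε| = 1)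
    (hsign : ∀ p ∈ PDisk x₀ y₀ (4 * r), |hessDet z p| = ε * hessDet z p) :
    ∫⁻ p in PDisk x₀ y₀ (4 * r), ENNReal.ofReal
        (bump (x₀, y₀) hr p * (b.σ ^ 3 / b.den z p ^ 3 * |hessDet z p|))
      ≤ ENNReal.ofReal ((∫ p in PDisk x₀ y₀ (4 * r), outerBound z (bump (x₀, y₀) hr) p)
        + ∫ p, hessBound (bump 0 one_pos) p) := by
  have hU := isOpen_pdisk x₀ y₀ (4 * r)
  have hs := b.contDiffOn_slopes hU hz hgrad
  set d : ℕ → ℝ := fun n => (1 - b.s) * r / 4 * (1 / ((n : ℝ) + 1)) with hd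
  have hm : 0 < (1 - b.s) * r / 4 := by
    have := sub_pos.2 b.s_lt_one
    positivity
  have hd0 : ∀ n, 0 < d n := fun n => by positivity
  have hdr : ∀ n, 4 * d n ≤ (1 - b.s) * r := fun n => by
    have : 1 / ((n : ℝ) + 1) ≤ 1 := by
      rw [div_le_one (by positivity)]
      linarith [n.cast_nonneg (α := ℝ)]
    have := mul_le_of_le_one_right hm.le this
    simp only [hd]
    linarith
  have hdt : Tendsto d atTop (nhdsWithin 0 (Ioi 0)) := by
    refine tendsto_nhdsWithin_iff.2 ⟨?_, Eventually.of_forall hd0⟩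
    simpa only [mul_zero] using (tendsto_one_div_add_atTop_nhds_zero_nat (𝕜 := ℝ)).const_mul ((1 - b.s) * r / 4)
  set F : ℕ → ℝ × ℝ → ENNReal := fun n p => ENNReal.ofReal
    (b.cutoff z (x₀, y₀) z₀ hr (d n) p * (b.σ ^ 3 / b.den z p ^ 3 * |hessDet z p|)) with hF
  have hlim : ∀ p ∈ PDisk x₀ y₀ (4 * r), ENNReal.ofReal
      (bump (x₀, y₀) hr p * (b.σ ^ 3 / b.den z p ^ 3 * |hessDet z p|))
        = liminf (fun n => F n p) atTop := by
    intro p hp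
    refine (Tendsto.liminf_eq (tendsto_const_nhds.congr' ?_)).symm
    filter_upwards [hdt.eventually (b.eventually_cutoff_eq hr (hz₀ p hp)
      ((mem_pdisk_iff (by positivity)).1 hp).1)] with n hn
    simp only [hF, hn]
  rw [setLIntegral_congr_fun hU.measurableSet hlim]
  refine (lintegral_liminf_le' fun n => ?_).trans ?_
  · refine AEMeasurable.ennreal_ofReal ?_
    have e : ∀ p ∈ PDisk x₀ y₀ (4 * r), b.cutoff z (x₀, y₀) z₀ hr (d n) p * |jac (b.P z) (b.Q z) p|
        = b.cutoff z (x₀, y₀) z₀ hr (d n) p * (b.σ ^ 3 / b.den z p ^ 3 * |hessDet z p|) := by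
      intro p hp
      have := b.den_pos (hgrad p hp)
      have := b.σ_pos
      rw [b.jac_slopes hU hz hgrad hp, abs_mul, abs_of_pos (by positivity)]
    have hC : ContinuousOn (fun p => b.cutoff z (x₀, y₀) z₀ hr (d n) p * |jac (b.P z) (b.Q z) p|)
        (PDisk x₀ y₀ (4 * r)) :=
      (b.contDiffOn_cutoff hr hz _).continuousOn.mul (continuousOn_jac hU hs.1 hs.2).abs
    exact (hC.congr fun p hp => (e p hp).symm).aemeasurable hU.measurableSet
  · refine (liminf_le_liminf (Eventually.of_forall fun n =>
      b.lintegral_cutoff_le hr hz hgrad hLip hz₀ hε hsign (hd0 n) (hdr n))).trans ?_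
    rw [liminf_const]

theorem one_sub_sq_pos {t : ℝ} (ht : t ∈ Ioo (0 : ℝ) 1) : 0 < 1 - (1 - t ^ 2) ^ 2 := by
  have h : 1 - (1 - t ^ 2) ^ 2 = t ^ 2 * (2 - t ^ 2) := by ring
  rw [h]
  exact mul_pos (pow_pos ht.1 2) (by nlinarith [ht.1, ht.2])

/-- The boost of velocity `1 - t ^ 2` in the direction of angle `θ`. -/
def ofParam (t θ : ℝ) (ht : t ∈ Ioo (0 : ℝ) 1) : Boost where
  C := cos θ
  S := sin θ
  s := 1 - t ^ 2
  σ := √(1 - (1 - t ^ 2) ^ 2)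
  rot := cos_sq_add_sin_sq θ
  hyp := by
    rw [Real.sq_sqrt]
    · ring
    · exact (one_sub_sq_pos ht).le
  s_nonneg := by nlinarith [ht.1, ht.2]
  s_lt_one := by nlinarith [ht.1, ht.2]
  σ_pos := Real.sqrt_pos.2 (one_sub_sq_pos ht)

theorem le_σ_ofParam {t θ : ℝ} (ht : t ∈ Ioo (0 : ℝ) 1) : t ≤ (ofParam t θ ht).σ := by
  apply Real.le_sqrt_of_sq_le
  nlinarith [ht.1, ht.2, mul_pos ht.1 ht.1, mul_lt_mul'' ht.2 ht.2 ht.1.le ht.1.le]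

end Boost

/-- A lower bound for the boost weight with parameters `v = (t, θ)`. -/
def weight (a : ℝ × ℝ) (v : ℝ × ℝ) : ℝ :=
  v.1 ^ 3 / (1 - (1 - v.1 ^ 2) * (cos v.2 * a.1 + sin v.2 * a.2)) ^ 3

theorem le_weight {w τ t θ : ℝ} (hw : 0 < w) (hw1 : w ≤ 1) (ht : t ∈ Ioo (w / 2) w)
    (hθ : θ ∈ Ioo (τ - w) (τ + w)) :
    1 / (125 * w ^ 3) ≤ weight (√(1 - w ^ 2) * cos τ, √(1 - w ^ 2) * sin τ) (t, θ) := by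
  have e : cos θ * (√(1 - w ^ 2) * cos τ) + sin θ * (√(1 - w ^ 2) * sin τ)
      = √(1 - w ^ 2) * cos (θ - τ) := by rw [cos_sub]; ring
  have ht0 : 0 < t := by linarith [ht.1]
  have hw2 : 0 ≤ 1 - w ^ 2 := by nlinarith
  have hc : 1 - w ^ 2 / 2 ≤ cos (θ - τ) := by
    have h₁ := Real.one_sub_sq_div_two_le_cos (x := θ - τ)
    have h₂ : (θ - τ) ^ 2 ≤ w ^ 2 := sq_le_sq' (by linarith [hθ.1]) (by linarith [hθ.2])
    linarith
  have hr : 1 - w ^ 2 ≤ √(1 - w ^ 2) := by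
    apply Real.le_sqrt_of_sq_le
    nlinarith [sq_nonneg w]
  have hr1 : √(1 - w ^ 2) < 1 := by
    rw [Real.sqrt_lt' one_pos]
    nlinarith
  have hs : 1 - w ^ 2 ≤ 1 - t ^ 2 := by nlinarith [ht.2]
  have hs1 : 1 - t ^ 2 < 1 := by nlinarith
  have h₁ : (1 - w ^ 2) * (1 - w ^ 2 / 2) ≤ √(1 - w ^ 2) * cos (θ - τ) :=
    mul_le_mul hr hc (by linarith) (by positivity)
  have h₂ : (1 - w ^ 2) * ((1 - w ^ 2) * (1 - w ^ 2 / 2))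
      ≤ (1 - t ^ 2) * (√(1 - w ^ 2) * cos (θ - τ)) :=
    mul_le_mul hs h₁ (mul_nonneg hw2 (by linarith)) (by linarith)
  have h₃ : 1 - (1 - t ^ 2) * (√(1 - w ^ 2) * cos (θ - τ)) ≤ 5 / 2 * w ^ 2 := by
    have : 1 - 5 / 2 * w ^ 2 ≤ (1 - w ^ 2) * ((1 - w ^ 2) * (1 - w ^ 2 / 2)) := by
      have : 0 ≤ w ^ 4 * (4 - w ^ 2) := mul_nonneg (by positivity) (by nlinarith)
      nlinarith
    linarith
  have h₄ : 0 < 1 - (1 - t ^ 2) * (√(1 - w ^ 2) * cos (θ - τ)) := by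
    have a₁ : √(1 - w ^ 2) * cos (θ - τ) ≤ √(1 - w ^ 2) :=
      mul_le_of_le_one_right (Real.sqrt_nonneg _) (cos_le_one _)
    have a₂ : (1 - t ^ 2) * (√(1 - w ^ 2) * cos (θ - τ)) ≤ (1 - t ^ 2) * √(1 - w ^ 2) :=
      mul_le_mul_of_nonneg_left a₁ (by linarith)
    have a₃ : (1 - t ^ 2) * √(1 - w ^ 2) ≤ √(1 - w ^ 2) :=
      mul_le_of_le_one_left (Real.sqrt_nonneg _) hs1.le
    linarith
  rw [weight, e]
  calc 1 / (125 * w ^ 3) = (w / 2) ^ 3 / (5 / 2 * w ^ 2) ^ 3 := by field_simp; norm_num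
    _ ≤ t ^ 3 / (5 / 2 * w ^ 2) ^ 3 := by gcongr; exact ht.1.le
    _ ≤ _ := by gcongr

theorem le_lintegral_weight {a : ℝ × ℝ} {w : ℝ} (hw : 0 < w) (ha : a.1 ^ 2 + a.2 ^ 2 = 1 - w ^ 2) :
    ENNReal.ofReal (1 / (125 * w))
      ≤ ∫⁻ v in Ioo (0 : ℝ) 1 ×ˢ Ioo (-(2 * π)) (2 * π), ENNReal.ofReal (weight a v) := by
  have hw1 : w ≤ 1 := by nlinarith [sq_nonneg a.1, sq_nonneg a.2]
  set τ := (⟨a.1, a.2⟩ : ℂ).arg with hτ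
  have hn : ‖(⟨a.1, a.2⟩ : ℂ)‖ = √(1 - w ^ 2) := by
    rw [← ha, Complex.norm_def, Complex.normSq_mk, sq, sq]
  have hae : a = (√(1 - w ^ 2) * cos τ, √(1 - w ^ 2) * sin τ) := by
    rw [← hn, hτ, Complex.norm_mul_cos_arg, Complex.norm_mul_sin_arg]
  have hsub : Ioo (w / 2) w ×ˢ Ioo (τ - w) (τ + w)
      ⊆ Ioo (0 : ℝ) 1 ×ˢ Ioo (-(2 * π)) (2 * π) := by
    have h₁ := Complex.neg_pi_lt_arg (⟨a.1, a.2⟩ : ℂ)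
    have h₂ := Complex.arg_le_pi (⟨a.1, a.2⟩ : ℂ)
    have h₃ := Real.pi_gt_three
    exact prod_mono (Ioo_subset_Ioo (by linarith) hw1)
      (Ioo_subset_Ioo (by linarith) (by linarith))
  have hmeas : MeasurableSet (Ioo (w / 2) w ×ˢ Ioo (τ - w) (τ + w)) :=
    measurableSet_Ioo.prod measurableSet_Ioo
  calc ENNReal.ofReal (1 / (125 * w))
      = ∫⁻ _ in Ioo (w / 2) w ×ˢ Ioo (τ - w) (τ + w), ENNReal.ofReal (1 / (125 * w ^ 3)) := by
        rw [setLIntegral_const, Measure.volume_eq_prod, Measure.prod_prod, Real.volume_Ioo,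
          Real.volume_Ioo, ← ENNReal.ofReal_mul (by linarith), ← ENNReal.ofReal_mul (by positivity)]
        congr 1
        field_simp
        ring
    _ ≤ ∫⁻ v in Ioo (w / 2) w ×ˢ Ioo (τ - w) (τ + w), ENNReal.ofReal (weight a v) := by
        refine setLIntegral_mono' hmeas fun v hv => ENNReal.ofReal_le_ofReal ?_
        rw [hae]
        exact le_weight hw hw1 hv.1 hv.2
    _ ≤ _ := lintegral_mono_set hsub

section Averaging

variable {z : ℝ × ℝ → ℝ} {x₀ y₀ r z₀ : ℝ}

theorem weight_le_ofParam {v p : ℝ × ℝ} (hv : v.1 ∈ Ioo (0 : ℝ) 1)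
    (hp : zx z p ^ 2 + zy z p ^ 2 < 1) :
    weight (zx z p, zy z p) v
      ≤ (Boost.ofParam v.1 v.2 hv).σ ^ 3 / (Boost.ofParam v.1 v.2 hv).den z p ^ 3 := by
  have hd := (Boost.ofParam v.1 v.2 hv).den_pos hp
  exact div_le_div_of_nonneg_right
    (pow_le_pow_left₀ hv.1.le (Boost.le_σ_ofParam hv) 3) (pow_pos hd 3).le

theorem continuousOn_weight {U : Set (ℝ × ℝ)} (hx : ContinuousOn (zx z) U)
    (hy : ContinuousOn (zy z) U) (hgrad : ∀ p ∈ U, zx z p ^ 2 + zy z p ^ 2 < 1) :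
    ContinuousOn (fun q : (ℝ × ℝ) × (ℝ × ℝ) => weight (zx z q.2, zy z q.2) q.1)
      ((Ioo (0 : ℝ) 1 ×ˢ Ioo (-(2 * π)) (2 * π)) ×ˢ U) := by
  have hx' : ContinuousOn (fun q : (ℝ × ℝ) × (ℝ × ℝ) => zx z q.2)
      ((Ioo (0 : ℝ) 1 ×ˢ Ioo (-(2 * π)) (2 * π)) ×ˢ U) :=
    hx.comp continuousOn_snd fun q hq => hq.2
  have hy' : ContinuousOn (fun q : (ℝ × ℝ) × (ℝ × ℝ) => zy z q.2)
      ((Ioo (0 : ℝ) 1 ×ˢ Ioo (-(2 * π)) (2 * π)) ×ˢ U) :=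
    hy.comp continuousOn_snd fun q hq => hq.2
  unfold weight
  refine ContinuousOn.div (by fun_prop) (by fun_prop) fun q hq => ?_
  exact (pow_pos ((Boost.ofParam q.1.1 q.1.2 hq.1.1).den_pos (hgrad q.2 hq.2)) 3).ne'

theorem continuousOn_hessDet {U : Set (ℝ × ℝ)} (hU : IsOpen U) (hz : ContDiffOn ℝ 2 z U) :
    ContinuousOn (hessDet z) U := by
  have h : ContDiffOn ℝ 1 (zx z) U ∧ ContDiffOn ℝ 1 (zy z) U :=
    contDiffOn_pd (m := 1) (n := 2) hU hz (by norm_num)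
  have h₁ : ContDiffOn ℝ 0 (zxx z) U ∧ ContDiffOn ℝ 0 (zxy z) U :=
    contDiffOn_pd (m := 0) (n := 1) hU h.1 (by norm_num)
  have h₂ : ContDiffOn ℝ 0 (pd1 (zy z)) U ∧ ContDiffOn ℝ 0 (zyy z) U :=
    contDiffOn_pd (m := 0) (n := 1) hU h.2 (by norm_num)
  exact (h₁.1.continuousOn.mul h₂.2.continuousOn).sub (h₁.2.continuousOn.pow 2)

/-- Averaging the boosted curvature integrals over all boosts bounds the curvature with the
weight `1 / √(1 - |∇z| ^ 2)`. -/
theorem lintegral_bump_mul_lt_top (hr : 0 < r) (hz : ContDiffOn ℝ 2 z (PDisk x₀ y₀ (4 * r)))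
    (hgrad : ∀ p ∈ PDisk x₀ y₀ (4 * r), zx z p ^ 2 + zy z p ^ 2 < 1)
    (hLip : ∀ p ∈ PDisk x₀ y₀ (4 * r), ∀ q ∈ PDisk x₀ y₀ (4 * r), |z q - z p| ≤ ed q p)
    (hz₀ : ∀ p ∈ PDisk x₀ y₀ (4 * r), |z p - z₀| ≤ ed p (x₀, y₀)) {ε : ℝ} (hε : |ε| = 1)
    (hsign : ∀ p ∈ PDisk x₀ y₀ (4 * r), |hessDet z p| = ε * hessDet z p) :
    ∫⁻ p in PDisk x₀ y₀ (4 * r), ENNReal.ofReal (bump (x₀, y₀) hr p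
      * |hessDet z p| * (1 / (125 * √(1 - zx z p ^ 2 - zy z p ^ 2)))) < ⊤ := by
  set U := PDisk x₀ y₀ (4 * r) with hUd
  set R : Set (ℝ × ℝ) := Ioo (0 : ℝ) 1 ×ˢ Ioo (-(2 * π)) (2 * π) with hR
  have hU : IsOpen U := isOpen_pdisk x₀ y₀ (4 * r)
  have hRm : MeasurableSet R := measurableSet_Ioo.prod measurableSet_Ioo
  have h : ContDiffOn ℝ 1 (zx z) U ∧ ContDiffOn ℝ 1 (zy z) U :=
    contDiffOn_pd (m := 1) (n := 2) hU hz (by norm_num)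
  have hB : ∀ p, 0 ≤ bump (x₀, y₀) hr p := fun p => (bump (x₀, y₀) hr).nonneg
  have hmeas : AEMeasurable (fun q : (ℝ × ℝ) × (ℝ × ℝ) => ENNReal.ofReal
      (bump (x₀, y₀) hr q.2 * |hessDet z q.2| * weight (zx z q.2, zy z q.2) q.1))
      ((volume.restrict R).prod (volume.restrict U)) := by
    rw [Measure.prod_restrict]
    refine (ContinuousOn.aemeasurable ?_ (hRm.prod hU.measurableSet)).ennreal_ofReal
    refine ContinuousOn.mul (ContinuousOn.mul ?_ ?_)
      (continuousOn_weight h.1.continuousOn h.2.continuousOn hgrad)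
    · exact ((bump (x₀, y₀) hr).continuous.comp continuous_snd).continuousOn
    · exact ((continuousOn_hessDet hU hz).comp continuousOn_snd fun q hq => hq.2).abs
  calc ∫⁻ p in U, ENNReal.ofReal (bump (x₀, y₀) hr p
        * |hessDet z p| * (1 / (125 * √(1 - zx z p ^ 2 - zy z p ^ 2))))
      ≤ ∫⁻ p in U, ∫⁻ v in R, ENNReal.ofReal (bump (x₀, y₀) hr p * |hessDet z p|
          * weight (zx z p, zy z p) v) := by
        refine setLIntegral_mono' hU.measurableSet fun p hp => ?_
        have hp' := hgrad p hp
        have hnn : 0 ≤ bump (x₀, y₀) hr p * |hessDet z p| := mul_nonneg (hB p) (abs_nonneg _)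
        simp only [ENNReal.ofReal_mul hnn]
        rw [lintegral_const_mul' _ _ ENNReal.ofReal_ne_top]
        gcongr
        refine le_lintegral_weight (Real.sqrt_pos.2 (by linarith)) ?_
        rw [Real.sq_sqrt (by linarith)]
        ring
    _ = ∫⁻ v in R, ∫⁻ p in U, ENNReal.ofReal (bump (x₀, y₀) hr p * |hessDet z p|
          * weight (zx z p, zy z p) v) :=
        (lintegral_lintegral_swap hmeas).symm
    _ ≤ ∫⁻ _ in R, ENNReal.ofReal ((∫ p in U, outerBound z (bump (x₀, y₀) hr) p)
          + ∫ p, hessBound (bump 0 one_pos) p) := by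
        refine setLIntegral_mono' hRm fun v hv => ?_
        refine le_trans (setLIntegral_mono' hU.measurableSet fun p hp => ?_)
          ((Boost.ofParam v.1 v.2 hv.1).lintegral_bump_le hr hz hgrad hLip hz₀ hε hsign)
        refine ENNReal.ofReal_le_ofReal ?_
        rw [mul_assoc, mul_comm |hessDet z p|]
        exact mul_le_mul_of_nonneg_left
          (mul_le_mul_of_nonneg_right (weight_le_ofParam hv.1 (hgrad p hp)) (abs_nonneg _)) (hB p)
    _ < ⊤ := by
        rw [setLIntegral_const, hR, Measure.volume_eq_prod, Measure.prod_prod, Real.volume_Ioo,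
          Real.volume_Ioo]
        exact ENNReal.mul_lt_top ENNReal.ofReal_lt_top
          (ENNReal.mul_lt_top ENNReal.ofReal_lt_top ENNReal.ofReal_lt_top)

theorem integrableOn_weighted_hessDet (hr : 0 < r)
    (hz : ContDiffOn ℝ 2 z (PDisk x₀ y₀ (4 * r)))
    (hgrad : ∀ p ∈ PDisk x₀ y₀ (4 * r), zx z p ^ 2 + zy z p ^ 2 < 1)
    (hLip : ∀ p ∈ PDisk x₀ y₀ (4 * r), ∀ q ∈ PDisk x₀ y₀ (4 * r), |z q - z p| ≤ ed q p)
    (hz₀ : ∀ p ∈ PDisk x₀ y₀ (4 * r), |z p - z₀| ≤ ed p (x₀, y₀)) {ε : ℝ} (hε : |ε| = 1)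
    (hsign : ∀ p ∈ PDisk x₀ y₀ (4 * r), |hessDet z p| = ε * hessDet z p) :
    IntegrableOn (fun p : ℝ × ℝ => (2 - zx z p ^ 2 - zy z p ^ 2)
      / √(1 - zx z p ^ 2 - zy z p ^ 2) * |hessDet z p|) (PDisk x₀ y₀ r) := by
  have hV := isOpen_pdisk x₀ y₀ r
  have hVU : PDisk x₀ y₀ r ⊆ PDisk x₀ y₀ (4 * r) := fun p hp =>
    ⟨hp.1, hp.2.trans (by nlinarith)⟩
  have h : ContDiffOn ℝ 1 (zx z) (PDisk x₀ y₀ r) ∧ ContDiffOn ℝ 1 (zy z) (PDisk x₀ y₀ r) :=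
    contDiffOn_pd (m := 1) (n := 2) hV (hz.mono hVU) (by norm_num)
  have hx := h.1.continuousOn
  have hy := h.2.continuousOn
  have hD := continuousOn_hessDet hV (hz.mono hVU)
  have hw : ∀ p ∈ PDisk x₀ y₀ r, 0 < √(1 - zx z p ^ 2 - zy z p ^ 2) := fun p hp =>
    Real.sqrt_pos.2 (by linarith [hgrad p (hVU hp)])
  have hnn : ∀ p ∈ PDisk x₀ y₀ r, 0 ≤ (2 - zx z p ^ 2 - zy z p ^ 2)
      / √(1 - zx z p ^ 2 - zy z p ^ 2) * |hessDet z p| := fun p hp =>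
    mul_nonneg (div_nonneg (by linarith [hgrad p (hVU hp)]) (hw p hp).le) (abs_nonneg _)
  refine ⟨ContinuousOn.aestronglyMeasurable ?_ hV.measurableSet, ?_⟩
  · exact (ContinuousOn.div (by fun_prop) (by fun_prop) fun p hp => (hw p hp).ne').mul hD.abs
  · rw [hasFiniteIntegral_iff_ofReal ((ae_restrict_mem hV.measurableSet).mono hnn)]
    calc ∫⁻ p in PDisk x₀ y₀ r, ENNReal.ofReal ((2 - zx z p ^ 2 - zy z p ^ 2)
          / √(1 - zx z p ^ 2 - zy z p ^ 2) * |hessDet z p|)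
        ≤ ∫⁻ p in PDisk x₀ y₀ r, ENNReal.ofReal 250 * ENNReal.ofReal (bump (x₀, y₀) hr p
          * |hessDet z p| * (1 / (125 * √(1 - zx z p ^ 2 - zy z p ^ 2)))) := by
          refine setLIntegral_mono' hV.measurableSet fun p hp => ?_
          rw [← ENNReal.ofReal_mul (by norm_num)]
          refine ENNReal.ofReal_le_ofReal ?_
          have hb : bump (x₀, y₀) hr p = 1 :=
            (bump (x₀, y₀) hr).one_of_mem_closedBall
              ((dist_le_ed _ _).trans ((mem_pdisk_iff hr).1 hp).2.le)
          have hwp := hw p hp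
          rw [hb, one_mul]
          calc _ ≤ 2 / √(1 - zx z p ^ 2 - zy z p ^ 2) * |hessDet z p| := by
                gcongr
                linarith [sq_nonneg (zx z p), sq_nonneg (zy z p)]
            _ = _ := by
                field_simp
                ring
      _ ≤ ∫⁻ p in PDisk x₀ y₀ (4 * r), ENNReal.ofReal 250 * ENNReal.ofReal
          (bump (x₀, y₀) hr p * |hessDet z p|
            * (1 / (125 * √(1 - zx z p ^ 2 - zy z p ^ 2)))) := lintegral_mono_set hVU
      _ < ⊤ := by
          rw [lintegral_const_mul' _ _ ENNReal.ofReal_ne_top]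
          exact ENNReal.mul_lt_top ENNReal.ofReal_lt_top
            (lintegral_bump_mul_lt_top hr hz hgrad hLip hz₀ hε hsign)

end Averaging

theorem exists_abs_eq_mul {f : ℝ × ℝ → ℝ} {U : Set (ℝ × ℝ)} (hU : IsPreconnected U)
    (hf : ContinuousOn f U) (h0 : ∀ p ∈ U, f p ≠ 0) :
    ∃ ε : ℝ, |ε| = 1 ∧ ∀ p ∈ U, |f p| = ε * f p := by
  by_cases hpos : ∀ p ∈ U, 0 < f p
  · exact ⟨1, abs_one, fun p hp => by rw [abs_of_pos (hpos p hp), one_mul]⟩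
  · push Not at hpos
    obtain ⟨q, hq, hfq⟩ := hpos
    refine ⟨-1, by simp, fun p hp => ?_⟩
    have : f p ≤ 0 := by
      by_contra! hfp
      obtain ⟨y, hy, hy0⟩ := hU.intermediate_value hq hp hf ⟨hfq, hfp.le⟩
      exact h0 y hy hy0
    rw [abs_of_nonpos this, neg_one_mul]

/-- integral bound from the proof of Lemma `anillo`: at a
non-removable singularity with nonvanishing Hessian determinant, the function
`(2 − z_x² − z_y²)(1 − z_x² − z_y²)^{−1/2} |z_xx z_yy − z_xy²|` is integrable on some
punctured neighborhood of `(x₀,y₀)`. -/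
theorem stmt15 (O : Set R3) (x₀ y₀ ρ : ℝ) (α : NNReal) (H : R3 → ℝ) (z : ℝ × ℝ → ℝ)
    (hα : 0 < α) (hα1 : (α : ℝ) < 1)
    (hO : IsOpen O) (hρ : 0 < ρ)
    (hH : IsCkalpha 1 α H O) (hHpos : ∀ p ∈ O, 0 < H p)
    (hz : IsEllSol H O (PDisk x₀ y₀ ρ) z)
    (hHess : ∃ ε : ℝ, 0 < ε ∧ ε ≤ ρ ∧ ∀ p ∈ PDisk x₀ y₀ ε, hessDet z p ≠ 0)
    (hnr : ¬ RemovableSing x₀ y₀ z) :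
    ∃ ε : ℝ, 0 < ε ∧ ε ≤ ρ ∧
      IntegrableOn
        (fun p : ℝ × ℝ =>
          (2 - (zx z p) ^ 2 - (zy z p) ^ 2)
            / Real.sqrt (1 - (zx z p) ^ 2 - (zy z p) ^ 2) * |hessDet z p|)
        (PDisk x₀ y₀ ε) volume := by
  obtain ⟨ε₀, hε₀, hε₀ρ, hdet⟩ := hHess
  obtain ⟨r, hr, rfl⟩ : ∃ r, 0 < r ∧ ε₀ = 4 * r := ⟨ε₀ / 4, by positivity, by ring⟩
  have hsub : PDisk x₀ y₀ (4 * r) ⊆ PDisk x₀ y₀ ρ := fun p hp =>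
    ⟨hp.1, hp.2.trans_le (pow_le_pow_left₀ hε₀.le hε₀ρ 2)⟩
  have hU := isOpen_pdisk x₀ y₀ (4 * r)
  have hz2 := hz.1.mono hsub
  have hgrad : ∀ p ∈ PDisk x₀ y₀ (4 * r), zx z p ^ 2 + zy z p ^ 2 < 1 := fun p hp =>
    hz.2.2.1 p (hsub hp)
  have hLip : ∀ p ∈ PDisk x₀ y₀ (4 * r), ∀ q ∈ PDisk x₀ y₀ (4 * r), |z q - z p| ≤ ed q p :=
    fun p hp q hq => abs_sub_le_ed
      (fun p hp => (hz2.contDiffAt (hU.mem_nhds hp)).differentiableAt two_ne_zero)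
      (fun p hp => (hgrad p hp).le) hp hq
  obtain ⟨z₀, hz₀⟩ := exists_abs_sub_le_ed (x₀, y₀) hLip
  obtain ⟨ε, hε, hsign⟩ := exists_abs_eq_mul (isPreconnected_pdisk x₀ y₀ hε₀)
    (continuousOn_hessDet hU hz2) hdet
  exact ⟨r, hr, by linarith, integrableOn_weighted_hessDet hr hz2 hgrad hLip hz₀ hε hsign⟩
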